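/- Let R be a valuation domain of finite Krull dimension d, let f ∈ R[X] be nonzero, and let A = R[X, Y_1,…,Y_n][f^{-1}] be the localization of the polynomial ring R[X, Y_1,…,Y_n] away from f. Then every finitely generated stably free A-module of rank ≥ d+1 is free. -/

import Mathlib

open Polynomial

section PartA
namespace S14

open Matrix in
/-- Two rows are equivalent when they differ by an invertible matrix. -/
def Eqv {A : Type*} [CommRing A] {m : ℕ} (v w : Fin m → A) : Prop :=
  ∃ M : (Matrix (Fin m) (Fin m) A)ˣ, v ᵥ* M.1 = w

/-- Unimodular rows. -/
def Unim {A : Type*} [CommRing A] {m : ℕ} (v : Fin m → A) : Prop :=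
  ∃ u : Fin m → A, v ⬝ᵥ u = 1

section
variable {A : Type*} [CommRing A] {m : ℕ}

theorem Eqv.refl (v : Fin m → A) : Eqv v v := ⟨1, by simp⟩

theorem Eqv.symm {v w : Fin m → A} (h : Eqv v w) : Eqv w v := by
  obtain ⟨M, rfl⟩ := h
  exact ⟨M⁻¹, by rw [Matrix.vecMul_vecMul, Units.mul_inv, Matrix.vecMul_one]⟩

theorem Eqv.trans {v w x : Fin m → A} (h : Eqv v w) (h' : Eqv w x) : Eqv v x := by
  obtain ⟨M, rfl⟩ := h
  obtain ⟨N, rfl⟩ := h'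
  exact ⟨M * N, by rw [Matrix.vecMul_vecMul, Units.val_mul]⟩

theorem Eqv.map {B : Type*} [CommRing B] (φ : A →+* B) {v w : Fin m → A} (h : Eqv v w) :
    Eqv (fun i => φ (v i)) (fun i => φ (w i)) := by
  obtain ⟨M, rfl⟩ := h
  refine ⟨Units.map (φ.mapMatrix : Matrix (Fin m) (Fin m) A →+* _).toMonoidHom M, ?_⟩
  ext i
  simp [RingHom.map_vecMul]
  rfl

theorem Unim.map {B : Type*} [CommRing B] (φ : A →+* B) {v : Fin m → A} (h : Unim v) :
    Unim (fun i => φ (v i)) := by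
  obtain ⟨u, hu⟩ := h
  refine ⟨fun i => φ (u i), ?_⟩
  have := congrArg φ hu
  simpa [dotProduct] using this

theorem Eqv.unim {v w : Fin m → A} (h : Eqv v w) (hv : Unim v) : Unim w := by
  obtain ⟨M, rfl⟩ := h
  obtain ⟨u, hu⟩ := hv
  refine ⟨M⁻¹.1.mulVec u, ?_⟩
  rw [← Matrix.dotProduct_mulVec, Matrix.mulVec_mulVec, Units.mul_inv, Matrix.one_mulVec, hu]

theorem eqv_rank_one (v p q : Fin m → A) (h : q ⬝ᵥ p = 0) : Eqv v (v + (v ⬝ᵥ p) • q) := by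
  have hz : Matrix.vecMulVec p q * Matrix.vecMulVec p q = 0 := by
    rw [Matrix.vecMulVec_mul_vecMulVec, h]; simp
  refine ⟨⟨1 + Matrix.vecMulVec p q, 1 - Matrix.vecMulVec p q, ?_, ?_⟩, ?_⟩
  · rw [add_mul, mul_sub, mul_sub, hz]; simp
  · rw [sub_mul, mul_add, mul_add, hz]; simp
  · rw [Matrix.vecMul_add, Matrix.vecMul_one, Matrix.vecMul_vecMulVec]

/-- change of the last entries by multiples of the entry 0 -/
theorem eqv_add_mul_zero {k : ℕ} (v : Fin (k + 1) → A) (c : Fin k → A) :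
    Eqv v (Fin.cons (v 0) (fun i => v i.succ + c i * v 0)) := by
  have := eqv_rank_one v (Fin.cons 1 0) (Fin.cons 0 c) (by simp [dotProduct, Fin.sum_univ_succ])
  convert this using 1
  ext i
  refine Fin.cases ?_ (fun i => ?_) i <;> simp [dotProduct, Fin.sum_univ_succ, mul_comm]

theorem eqv_zero_add {k : ℕ} (v : Fin (k + 1) → A) (c : Fin k → A) :
    Eqv v (Fin.cons (v 0 + ∑ i, c i * v i.succ) (fun i => v i.succ)) := by
  have := eqv_rank_one v (Fin.cons 0 c) (Fin.cons 1 0) (by simp [dotProduct, Fin.sum_univ_succ])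
  convert this using 1
  ext i
  refine Fin.cases ?_ (fun i => ?_) i <;> simp [dotProduct, Fin.sum_univ_succ, mul_comm]

theorem eqv_one_add {k : ℕ} (v : Fin (k + 2) → A) (c : Fin k → A) :
    Eqv v (Fin.cons (v 0) (Fin.cons (v 1 + ∑ i, c i * v i.succ.succ) (fun i => v i.succ.succ))) := by
  have := eqv_rank_one v (Fin.cons 0 (Fin.cons 0 c)) (Fin.cons 0 (Fin.cons 1 0))
    (by simp [dotProduct, Fin.sum_univ_succ])
  convert this using 1
  ext i
  refine Fin.cases ?_ (fun i => Fin.cases ?_ (fun i => ?_) i) i <;>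
    simp [dotProduct, Fin.sum_univ_succ, mul_comm]

theorem eqv_smul_unit (v : Fin m → A) (c : Fin m → Aˣ) : Eqv v (fun i => v i * c i) := by
  refine ⟨⟨Matrix.diagonal (fun i => (c i : A)), Matrix.diagonal (fun i => ((c i)⁻¹ : Aˣ).1),
    ?_, ?_⟩, ?_⟩
  · simp [Matrix.diagonal_mul_diagonal]
  · simp [Matrix.diagonal_mul_diagonal]
  · ext i; simp [Matrix.vecMul_diagonal]

/-- the matrix with a two by two block in the corner -/
def blk (k : ℕ) (a b c d : A) : Matrix (Fin (k + 2)) (Fin (k + 2)) A :=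
  Fin.cons (Fin.cons a (Fin.cons b 0)) (Fin.cons (Fin.cons c (Fin.cons d 0))
    (fun i => Fin.cons 0 (Fin.cons 0 (Pi.single i 1))))

theorem blk_mul (k : ℕ) (a b c d : A) (h : a * d - b * c = 1) :
    blk k a b c d * blk k d (-b) (-c) a = 1 := by
  have e1 : a * d + -(b * c) = 1 := by linear_combination h
  have e2 : -(c * b) + d * a = 1 := by linear_combination h
  have e3 : -(a * b) + b * a = 0 := by ring
  have e4 : c * d + -(d * c) = 0 := by ring
  ext i j
  rw [Matrix.mul_apply, Fin.sum_univ_succ, Fin.sum_univ_succ]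
  refine Fin.cases ?_ (fun i => Fin.cases ?_ (fun i => ?_) i) i <;>
  refine Fin.cases ?_ (fun j => Fin.cases ?_ (fun j => ?_) j) j <;>
  simp [blk, e1, e2, e3, e4, Matrix.one_apply, Pi.single_apply, Fin.ext_iff]
  simp only [← Fin.ext_iff]
  simp [eq_comm]

theorem eqv_blk {k : ℕ} (v : Fin (k + 2) → A) (a b c d : A) (h : a * d - b * c = 1) :
    Eqv v (Fin.cons (v 0 * a + v 1 * c) (Fin.cons (v 0 * b + v 1 * d) (fun i => v i.succ.succ))) := by
  refine ⟨⟨blk k a b c d, blk k d (-b) (-c) a, blk_mul k a b c d h, ?_⟩, ?_⟩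
  · have := blk_mul k d (-b) (-c) a (by linear_combination h)
    simpa using this
  · ext j
    simp only [Matrix.vecMul, dotProduct]
    rw [Fin.sum_univ_succ, Fin.sum_univ_succ]
    refine Fin.cases ?_ (fun j => Fin.cases ?_ (fun j => ?_) j) j <;>
    simp [blk, Pi.single_apply]

end
end S14
end PartA

section PartB
namespace S14

theorem exists_prime_lt {A : Type*} [CommRing A] (b : A) (q : PrimeSpectrum A)
    (hb : b ∈ q.asIdeal)
    (hk : RingHom.ker (algebraMap A (Localization.Away b)) ≤ q.asIdeal) :
    ∃ q' : PrimeSpectrum A, q' < q := by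
  have hdis : Disjoint ((⊥ : Ideal A) : Set A)
      ((Submonoid.powers b ⊔ q.asIdeal.primeCompl : Submonoid A) : Set A) := by
    rw [Set.disjoint_left]
    intro x hx hx'
    have hx0 : x = 0 := by simpa using hx
    subst hx0
    obtain ⟨y, ⟨N, rfl⟩, z, hz, hyz⟩ := Submonoid.mem_sup.1 hx'
    apply hz
    apply hk
    rw [RingHom.mem_ker, IsLocalization.map_eq_zero_iff (Submonoid.powers b)]
    exact ⟨⟨b ^ N, N, rfl⟩, hyz⟩
  obtain ⟨p, hp, -, hpd⟩ := Ideal.exists_le_prime_disjoint _ _ hdis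
  rw [Set.disjoint_left] at hpd
  refine ⟨⟨p, hp⟩, ?_⟩
  rw [← PrimeSpectrum.asIdeal_lt_asIdeal]
  refine lt_of_le_of_ne ?_ ?_
  · intro x hx
    by_contra hxq
    exact hpd hx ((le_sup_right : _ ≤ Submonoid.powers b ⊔ q.asIdeal.primeCompl) hxq)
  · intro h
    have : b ∈ p := by
      have h' : p = q.asIdeal := h
      rw [h']; exact hb
    exact hpd this ((le_sup_left : _ ≤ Submonoid.powers b ⊔ q.asIdeal.primeCompl) ⟨1, by simp⟩)

theorem dim_boundary {A : Type*} [CommRing A] (b : A) (n : ℕ)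
    (hA : ringKrullDim A < (n + 1 : ℕ)) :
    ringKrullDim (A ⧸ (Ideal.span {b} ⊔ RingHom.ker (algebraMap A (Localization.Away b)))) < n := by
  set J := Ideal.span {b} ⊔ RingHom.ker (algebraMap A (Localization.Away b)) with hJ
  by_contra hcon
  rw [not_lt] at hcon
  obtain ⟨p, hp⟩ := Order.le_krullDim_iff.1 hcon
  let p' : LTSeries (PrimeSpectrum A) := p.map (PrimeSpectrum.comap (Ideal.Quotient.mk J))
    (by
      intro x y hxy
      rw [← PrimeSpectrum.asIdeal_lt_asIdeal] at hxy ⊢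
      refine lt_of_le_of_ne (Ideal.comap_mono hxy.le) ?_
      intro h
      exact hxy.ne (Ideal.comap_injective_of_surjective _ Ideal.Quotient.mk_surjective h))
  have hhead : J ≤ p'.head.asIdeal := by
    intro x hx
    have : p'.head = PrimeSpectrum.comap (Ideal.Quotient.mk J) p.head := rfl
    rw [this]
    show Ideal.Quotient.mk J x ∈ p.head.asIdeal
    rw [Ideal.Quotient.eq_zero_iff_mem.2 hx]
    exact zero_mem _
  obtain ⟨q, hq⟩ := exists_prime_lt b p'.head
    (hhead (Ideal.mem_sup_left (Ideal.mem_span_singleton_self b)))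
    (le_trans le_sup_right hhead)
  have := Order.LTSeries.length_le_krullDim (p'.cons q hq)
  have h2 : (p'.cons q hq).length = n + 1 := by
    have : p'.length = n := hp
    simp [this]
  rw [h2] at this
  exact absurd (lt_of_le_of_lt this hA) (lt_irrefl _)

universe u v

/-- Non-noetherian stable range theorem. -/
theorem stable_range (n : ℕ) : ∀ {A : Type u} [CommRing A] (_ : ringKrullDim A < n)
    {L : Type v} [CommRing L] (φ : L →+* A) (_ : ∀ a, ∃ c, ∃ w : Aˣ, a = φ c * w)
    (a : L) (b : Fin n → L)
    (_ : Ideal.span ({φ a} ∪ Set.range (fun i => φ (b i))) = ⊤),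
    ∃ c : Fin n → L, Ideal.span (Set.range (fun i => φ (b i + c i * a))) = ⊤ := by
  induction n with
  | zero =>
    intro A _ hA L _ φ hφ a b h
    have : ringKrullDim A = ⊥ := by
      rw [Nat.cast_zero] at hA
      by_contra hne
      have : Nontrivial A := by
        rw [← not_subsingleton_iff_nontrivial]
        intro hs
        exact hne ringKrullDim_eq_bot_of_subsingleton
      exact absurd hA (not_lt.2 ringKrullDim_nonneg_of_nontrivial)
    have hs : Subsingleton A := by
      by_contra hns
      rw [not_subsingleton_iff_nontrivial] at hns
      have := ringKrullDim_nonneg_of_nontrivial (R := A)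
      simp_all
    exact ⟨Fin.elim0, Subsingleton.elim _ _⟩
  | succ n ih =>
    intro A _ hA L _ φ hφ a b h
    set β := φ (b (Fin.last n)) with hβ
    set J := Ideal.span {β} ⊔ RingHom.ker (algebraMap A (Localization.Away β)) with hJ
    have hdim := dim_boundary β n hA
    obtain ⟨c, hc⟩ := ih hdim ((Ideal.Quotient.mk J).comp φ) (by
      intro x
      obtain ⟨x, rfl⟩ := Ideal.Quotient.mk_surjective x
      obtain ⟨c, w, rfl⟩ := hφ x
      exact ⟨c, Units.map (Ideal.Quotient.mk J).toMonoidHom w, map_mul _ _ _⟩) a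
      (fun i => b i.castSucc) (by
        have h2 := congrArg (Ideal.map (Ideal.Quotient.mk J)) h
        rw [Ideal.map_span, Ideal.map_top] at h2
        rw [eq_top_iff, ← h2, Ideal.span_le]
        rintro _ ⟨x, (rfl | ⟨i, rfl⟩), rfl⟩
        · exact Ideal.subset_span (Or.inl rfl)
        · refine Fin.lastCases ?_ (fun i => ?_) i
          · have : Ideal.Quotient.mk J β = 0 :=
              Ideal.Quotient.eq_zero_iff_mem.2
                (Ideal.mem_sup_left (Ideal.mem_span_singleton_self β))
            simp only [← hβ, this]
            exact zero_mem _
          · exact Ideal.subset_span (Or.inr ⟨i, rfl⟩))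
    -- lift
    have h1 : (1 : A) ∈ Ideal.span (Set.range (fun i : Fin n => φ (b i.castSucc + c i * a))) ⊔ J := by
      have : Ideal.map (Ideal.Quotient.mk J)
          (Ideal.span (Set.range (fun i : Fin n => φ (b i.castSucc + c i * a)))) = ⊤ := by
        rw [Ideal.map_span, ← hc, ← Set.range_comp]
        rfl
      have h3 := congrArg (Ideal.comap (Ideal.Quotient.mk J)) this
      rw [Ideal.comap_map_of_surjective _ Ideal.Quotient.mk_surjective, Ideal.comap_top] at h3
      have h4 : Ideal.comap (Ideal.Quotient.mk J) ⊥ = J := by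
        rw [← RingHom.ker_eq_comap_bot, Ideal.mk_ker]
      rw [h4] at h3
      rw [h3]; trivial
    obtain ⟨y, hy, j, hj, hyj⟩ := Submodule.mem_sup.1 h1
    obtain ⟨z, hz, e, he, rfl⟩ := Submodule.mem_sup.1 hj
    obtain ⟨e, w, rfl⟩ := hφ e
    have he' : φ e ∈ RingHom.ker (algebraMap A (Localization.Away β)) := by
      have := Ideal.mul_mem_right (↑w⁻¹ : A) _ he
      simpa [mul_assoc] using this
    rw [RingHom.mem_ker, IsLocalization.map_eq_zero_iff (Submonoid.powers β)] at he'
    obtain ⟨⟨_, N, rfl⟩, hN⟩ := he'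
    refine ⟨Fin.snoc c e, ?_⟩
    by_contra hne
    obtain ⟨M, hM, hle⟩ := Ideal.exists_le_maximal _ hne
    have hmem : ∀ i, φ (b i + (Fin.snoc c e : Fin (n + 1) → L) i * a) ∈ M := fun i =>
      hle (Ideal.subset_span ⟨i, rfl⟩)
    have hlast : β + φ e * φ a ∈ M := by
      have := hmem (Fin.last n)
      simpa using this
    have hprod : β ∈ M ∨ φ e ∈ M := by
      have : β ^ N * φ e ∈ M := by
        show β ^ N * φ e ∈ M
        rw [show β ^ N * φ e = 0 from hN]; exact zero_mem _
      rcases hM.isPrime.mem_or_mem this with h | h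
      · exact Or.inl (hM.isPrime.mem_of_pow_mem _ h)
      · exact Or.inr h
    have hβM : β ∈ M := by
      rcases hprod with h | h
      · exact h
      · have := M.sub_mem hlast (M.mul_mem_right (φ a) h)
        simpa using this
    have hyM : y ∈ M := by
      refine (Ideal.span_le.2 ?_) hy
      rintro _ ⟨i, rfl⟩
      have := hmem i.castSucc
      simpa using this
    have hzM : z ∈ M := (Ideal.span_singleton_le_iff_mem M).2 hβM hz
    have heaM : φ e * φ a ∈ M := by
      have := M.sub_mem hlast hβM
      simpa using this
    rcases hM.isPrime.mem_or_mem heaM with he | ha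
    · apply hM.ne_top
      rw [Ideal.eq_top_iff_one, ← hyj]
      exact M.add_mem hyM (M.add_mem hzM (M.mul_mem_right _ he))
    · apply hM.ne_top
      rw [eq_top_iff, ← h, Ideal.span_le]
      rintro _ (rfl | ⟨i, rfl⟩)
      · exact ha
      · have := M.sub_mem (hmem i) (M.mul_mem_left (φ ((Fin.snoc c e : Fin (n + 1) → L) i)) ha)
        simpa using this

end S14
end PartB

section PartC
namespace S14

section
variable {S : Type*} [CommRing S] {m : ℕ}

/-- Quillen type ideal of a row of polynomials. -/
def Iv (v : Fin m → S[X]) : Ideal S where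
  carrier := {c | ∀ y z : S[X], Eqv (fun i => (v i).comp (y + C c * z)) (fun i => (v i).comp y)}
  add_mem' := by
    intro a b ha hb y z
    have h1 := ha (y + C b * z) z
    have h2 := hb y z
    have e : y + C (a + b) * z = y + C b * z + C a * z := by rw [C_add]; ring
    rw [e]
    exact h1.trans h2
  zero_mem' := by
    intro y z
    simpa using Eqv.refl _
  smul_mem' := by
    intro r a ha y z
    have h1 := ha y (C r * z)
    have e : y + C (r • a) * z = y + C a * (C r * z) := by simp [smul_eq_mul]; ring
    rw [e]
    exact h1

theorem mem_Iv {v : Fin m → S[X]} {c : S} : c ∈ Iv v ↔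
    ∀ y z : S[X], Eqv (fun i => (v i).comp (y + C c * z)) (fun i => (v i).comp y) := Iff.rfl

/-- if rows are equivalent over `S[X]` then they have the same ideal. -/
theorem Iv_le_of_eqv {v w : Fin m → S[X]} (h : Eqv v w) : Iv v ≤ Iv w := by
  intro c hc y z
  have h1 : ∀ y : S[X], Eqv (fun i => (v i).comp y) (fun i => (w i).comp y) := fun y =>
    h.map (compRingHom y)
  exact ((h1 _).symm.trans (hc y z)).trans (h1 y)

theorem exists_comp_sub (p y z : S[X]) (c : S) :
    ∃ δ, p.comp (y + C c * z) = p.comp y + C c * δ := by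
  have := Polynomial.sub_dvd_eval_sub (y + C c * z) y (p.map C)
  rw [eval_map, eval_map, ← comp, ← comp] at this
  obtain ⟨q, hq⟩ := this
  exact ⟨z * q, by linear_combination hq⟩

theorem blk_alg {B : Type*} [CommRing B] [IsDomain B] {c a b α β V0 V1 n0 n1 : B} (hc : c ≠ 0)
    (e1 : c = a * V0 + b * V1)
    (e2 : c = (a + c * α) * (V0 + c * n0) + (b + c * β) * (V1 + c * n1)) :
    (1 + α * V0 + n1 * b) * (1 + β * V1 + n0 * a) - (α * V1 - n1 * a) * (β * V0 - n0 * b) = 1 ∧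
    (V0 + c * n0) * (1 + α * V0 + n1 * b) + (V1 + c * n1) * (β * V0 - n0 * b) = V0 ∧
    (V0 + c * n0) * (α * V1 - n1 * a) + (V1 + c * n1) * (1 + β * V1 + n0 * a) = V1 := by
  have h00 : c * (1 + α * V0 + n1 * b) = (a + c * α) * V0 + (V1 + c * n1) * b := by
    linear_combination e1
  have h11 : c * (1 + β * V1 + n0 * a) = (b + c * β) * V1 + (V0 + c * n0) * a := by
    linear_combination e1
  have h01 : c * (α * V1 - n1 * a) = (a + c * α) * V1 - (V1 + c * n1) * a := by ring
  have h10 : c * (β * V0 - n0 * b) = (b + c * β) * V0 - (V0 + c * n0) * b := by ring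
  generalize (1 + α * V0 + n1 * b) = N00 at *
  generalize (1 + β * V1 + n0 * a) = N11 at *
  generalize (α * V1 - n1 * a) = N01 at *
  generalize (β * V0 - n0 * b) = N10 at *
  generalize (a + c * α) = a' at *
  generalize (b + c * β) = b' at *
  generalize (V0 + c * n0) = V0' at *
  generalize (V1 + c * n1) = V1' at *
  refine ⟨?_, ?_, ?_⟩
  · apply mul_left_cancel₀ (mul_ne_zero hc hc)
    have : c * c * (N00 * N11 - N01 * N10) = (c * N00) * (c * N11) - (c * N01) * (c * N10) := by ring
    rw [this, h00, h01, h10, h11]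
    have : c * c * 1 = (a * V0 + b * V1) * (a' * V0' + b' * V1') := by
      rw [← e1, ← e2]; ring
    rw [this]; ring
  · apply mul_left_cancel₀ hc
    linear_combination V0' * h00 + V1' * h10 - V0 * e2
  · apply mul_left_cancel₀ hc
    linear_combination V0' * h01 + V1' * h11 - V1 * e2

theorem mem_Iv_of_comb [IsDomain S] {k : ℕ} (v : Fin (k + 2) → S[X]) (c : S) (hc0 : c ≠ 0)
    (a b : S[X]) (h : C c = a * v 0 + b * v 1) : c ∈ Iv v := by
  intro y z
  choose δ hδ using fun p => exists_comp_sub (S := S) p y z c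
  have hc : C c ≠ 0 := by simpa using hc0
  set V : Fin (k + 2) → S[X] := fun i => (v i).comp y with hV
  have hV' : (fun i => (v i).comp (y + C c * z)) = fun i => V i + C c * δ (v i) := by
    ext1 i; exact hδ _
  rw [hV']
  set a0 := a.comp y
  set b0 := b.comp y
  set α := δ a
  set β := δ b
  set ν : Fin (k + 2) → S[X] := fun i => δ (v i) with hν
  have e1 : C c = a0 * V 0 + b0 * V 1 := by
    have := congrArg (fun p => p.comp y) h
    simpa using this
  have e2 : C c = (a0 + C c * α) * (V 0 + C c * ν 0) + (b0 + C c * β) * (V 1 + C c * ν 1) := by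
    have := congrArg (fun p => p.comp (y + C c * z)) h
    simp only [C_comp, add_comp, mul_comp] at this
    rw [hδ a, hδ b, hδ (v 0), hδ (v 1)] at this
    exact this
  set V' : Fin (k + 2) → S[X] := fun i => V i + C c * ν i with hV'
  -- move 1
  have m1 := eqv_rank_one V' (Fin.cons (a0 + C c * α) (Fin.cons (b0 + C c * β) 0))
    (Fin.cons 0 (Fin.cons 0 (fun i => - ν i.succ.succ))) (by simp [dotProduct, Fin.sum_univ_succ])
  have d1 : V' ⬝ᵥ (Fin.cons (a0 + C c * α) (Fin.cons (b0 + C c * β) 0)) = C c := by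
    refine Eq.trans ?_ e2.symm
    simp [dotProduct, Fin.sum_univ_succ, V']; ring
  rw [d1] at m1
  refine m1.trans ?_
  have E : (V' + C c • (Fin.cons 0 (Fin.cons 0 (fun i => - ν i.succ.succ)) : Fin (k + 2) → S[X]))
      = Fin.cons (V' 0) (Fin.cons (V' 1) (fun i => V i.succ.succ)) := by
    ext1 i
    refine Fin.cases ?_ (fun i => Fin.cases ?_ (fun i => ?_) i) i <;> simp [V']
  rw [E]
  obtain ⟨b1, b2, b3⟩ := blk_alg hc e1 e2
  have m2 := eqv_blk (Fin.cons (V' 0) (Fin.cons (V' 1) (fun i => V i.succ.succ)))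
    (1 + α * V 0 + ν 1 * b0) (α * V 1 - ν 1 * a0) (β * V 0 - ν 0 * b0) (1 + β * V 1 + ν 0 * a0) b1
  refine m2.trans ?_
  have : V = (Fin.cons (V 0) (Fin.cons (V 1) (fun i => V i.succ.succ)) : Fin (k + 2) → S[X]) := by
    ext1 i
    refine Fin.cases ?_ (fun i => Fin.cases ?_ (fun i => ?_) i) i <;> simp
  rw [this]
  convert Eqv.refl _ using 2
  · exact b2.symm
  · congr 1
    exact b3.symm

end
end S14
end PartC

section PartC2
namespace S14

theorem coprime_field {S K : Type*} [CommRing S] [Field K] (ψ : S →+* K)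
    (hψ : ∀ x : K, ∃ a b : S, ψ b ≠ 0 ∧ x * ψ b = ψ a) (p q r : S[X]) (hp : p.map ψ ≠ 0)
    (h : ∃ x y z, x * p + y * q + z * r = 1) :
    ∃ c : S[X], IsCoprime (p.map ψ) ((q + c * r).map ψ) := by
  have hfrac : ∀ x : K[X], ∃ a : S[X], ∃ b : S, ψ b ≠ 0 ∧ x * C (ψ b) = a.map ψ := by
    intro x
    induction x using Polynomial.induction_on' with
    | add x y hx hy =>
      obtain ⟨a, b, hb, e⟩ := hx
      obtain ⟨a', b', hb', e'⟩ := hy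
      refine ⟨a * C b' + a' * C b, b * b', by simp [hb, hb'], ?_⟩
      simp only [Polynomial.map_add, Polynomial.map_mul, map_C, ← e, ← e', map_mul]
      ring
    | monomial n x =>
      obtain ⟨a, b, hb, e⟩ := hψ x
      refine ⟨monomial n a, b, hb, ?_⟩
      rw [map_monomial, ← e, monomial_mul_C]
  set I := Ideal.span {p.map ψ}
  have hdim : ringKrullDim (K[X] ⧸ I) < (1 : ℕ) := by
    have hfin : Module.Finite K (AdjoinRoot (p.map ψ)) := (AdjoinRoot.powerBasis hp).finite
    have : IsArtinianRing (AdjoinRoot (p.map ψ)) := IsArtinianRing.of_finite K _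
    have h0 : Ring.KrullDimLE 0 (AdjoinRoot (p.map ψ)) := inferInstance
    have h1 : ringKrullDim (AdjoinRoot (p.map ψ)) ≤ 0 := by
      simpa using (Ring.krullDimLE_iff (n := 0)).1 h0
    refine lt_of_le_of_lt (h1) ?_
    norm_num
  obtain ⟨x, y, z, hxyz⟩ := h
  let φ : S[X] →+* K[X] ⧸ I := (Ideal.Quotient.mk I).comp (mapRingHom ψ)
  have hφp : φ p = 0 := by
    apply Ideal.Quotient.eq_zero_iff_mem.2
    exact Ideal.mem_span_singleton_self _
  obtain ⟨c, hc⟩ := stable_range 1 hdim φ (by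
    intro a
    obtain ⟨a, rfl⟩ := Ideal.Quotient.mk_surjective a
    obtain ⟨a', b, hb, e⟩ := hfrac a
    have hu : IsUnit (C (ψ b) : K[X]) := isUnit_C.2 (isUnit_iff_ne_zero.2 hb)
    have hu' : IsUnit (Ideal.Quotient.mk I (C (ψ b))) := hu.map _
    refine ⟨a', hu'.unit⁻¹, ?_⟩
    rw [Units.eq_mul_inv_iff_mul_eq]
    show Ideal.Quotient.mk I a * Ideal.Quotient.mk I (C (ψ b)) = Ideal.Quotient.mk I (a'.map ψ)
    rw [← e, map_mul]) r (fun _ => q) (by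
    rw [Ideal.eq_top_iff_one]
    have : (1 : K[X] ⧸ I) = φ y * φ q + φ z * φ r := by
      have := congrArg φ hxyz
      simp only [map_add, map_mul, hφp, map_one] at this
      rw [← this]; ring
    rw [this]
    exact Ideal.add_mem _ (Ideal.mul_mem_left _ _ (Ideal.subset_span (Or.inr ⟨0, rfl⟩)))
      (Ideal.mul_mem_left _ _ (Ideal.subset_span (Or.inl rfl))))
  refine ⟨c 0, ?_⟩
  have hr : (Set.range fun i : Fin 1 => φ (q + c i * r)) = {φ (q + c 0 * r)} := by
    ext t; simp [eq_comm]
  rw [hr, Ideal.span_singleton_eq_top, isUnit_iff_exists_inv] at hc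
  obtain ⟨t, ht⟩ := hc
  obtain ⟨t, rfl⟩ := Ideal.Quotient.mk_surjective t
  have : Ideal.Quotient.mk I ((q + c 0 * r).map ψ * t) = Ideal.Quotient.mk I 1 := by
    rw [map_mul, map_one, ← ht]; rfl
  rw [Ideal.Quotient.eq, Ideal.mem_span_singleton] at this
  obtain ⟨s, hs⟩ := this
  exact ⟨-s, t, by linear_combination hs⟩

theorem lc_mem_radical {S : Type*} [CommRing S] [IsDomain S] {k : ℕ} (v : Fin (k + 2) → S[X])
    (hv : Unim v) : (v 0).leadingCoeff ∈ (Iv v).radical := by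
  rw [Ideal.radical_eq_sInf, Ideal.mem_sInf]
  rintro M ⟨hIM, hM⟩
  by_contra hg
  let K := FractionRing (S ⧸ M)
  let ψ : S →+* K := (algebraMap (S ⧸ M) K).comp (Ideal.Quotient.mk M)
  have hψ0 : ∀ x, ψ x = 0 ↔ x ∈ M := by
    intro x
    simp only [ψ, RingHom.comp_apply, map_eq_zero_iff _ (IsFractionRing.injective (S ⧸ M) K)]
    exact Ideal.Quotient.eq_zero_iff_mem
  have hψ : ∀ x : K, ∃ a b : S, ψ b ≠ 0 ∧ x * ψ b = ψ a := by
    intro x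
    obtain ⟨⟨a, b⟩, h⟩ := IsLocalization.surj (nonZeroDivisors (S ⧸ M)) x
    obtain ⟨a, rfl⟩ := Ideal.Quotient.mk_surjective a
    obtain ⟨b, hb⟩ := b
    obtain ⟨b, rfl⟩ := Ideal.Quotient.mk_surjective b
    refine ⟨a, b, ?_, h⟩
    rw [Ne, hψ0, ← Ideal.Quotient.eq_zero_iff_mem]
    exact nonZeroDivisors.ne_zero hb
  have hlc : ((v 0).map ψ).coeff (v 0).natDegree ≠ 0 := by
    rw [coeff_map, coeff_natDegree, Ne, hψ0]; exact hg
  have hp : (v 0).map ψ ≠ 0 := by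
    intro h; rw [h] at hlc; simp at hlc
  obtain ⟨u, hu⟩ := hv
  obtain ⟨c, hc⟩ := coprime_field ψ hψ (v 0) (v 1) (∑ i : Fin k, u i.succ.succ * v i.succ.succ) hp
    ⟨u 0, u 1, 1, by
      refine Eq.trans ?_ hu; simp [dotProduct, Fin.sum_univ_succ, mul_comm]; ring⟩
  have hE := eqv_one_add v (fun i => c * u i.succ.succ)
  set w := v 1 + c * (∑ i : Fin k, u i.succ.succ * v i.succ.succ) with hw
  have hw' : v 1 + ∑ i : Fin k, c * u i.succ.succ * v i.succ.succ = w := by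
    rw [hw, Finset.mul_sum]; simp only [mul_assoc]
  rw [hw'] at hE
  obtain ⟨a, b, -, -, hab⟩ := exists_mul_add_mul_eq_C_resultant (m := (v 0).natDegree)
    (n := w.natDegree + 1) (v 0) w le_rfl (Nat.le_succ _) (Or.inr (Nat.succ_ne_zero _))
  set ρ := (v 0).resultant w (v 0).natDegree (w.natDegree + 1)
  have hρ : ρ ∉ M := by
    rw [← hψ0, ← resultant_map_map]
    have hle : (w.map ψ).natDegree ≤ w.natDegree := natDegree_map_le
    have : w.natDegree + 1 = (w.map ψ).natDegree + (w.natDegree + 1 - (w.map ψ).natDegree) := by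
      omega
    rw [this, resultant_add_right_deg _ _ _ _ _ le_rfl]
    refine mul_ne_zero (pow_ne_zero _ hlc) ?_
    have hd : (v 0).natDegree = ((v 0).map ψ).natDegree := by
      refine le_antisymm (le_natDegree_of_ne_zero hlc) natDegree_map_le
    rw [hd]
    exact resultant_ne_zero _ _ hc
  apply hρ
  apply hIM
  apply Iv_le_of_eqv hE.symm
  refine mem_Iv_of_comb _ ρ ?_ a b ?_
  · rintro h0; rw [h0] at hρ; exact hρ M.zero_mem
  · rw [← hab]; simp [mul_comm]

end S14
end PartC2

section PartD1
namespace S14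

/-- independence of a family over `R`, where `R` need not embed. -/
def Indep {R L : Type*} [CommRing R] [CommRing L] (ρ : R →+* L) {a : ℕ} (x : Fin a → L) : Prop :=
  ∀ F : MvPolynomial (Fin a) R, F.eval₂ ρ x = 0 → F.map ρ = 0

/-- `ρ : R → L` has potential at least `N`. -/
def Pot {R L : Type*} [CommRing R] [CommRing L] (ρ : R →+* L) (N : ℕ) : Prop :=
  ∃ (a : ℕ) (l : LTSeries (PrimeSpectrum R)), N ≤ a + l.length ∧
    (∃ x : Fin a → L, Indep ρ x) ∧ RingHom.ker ρ ≤ l.head.asIdeal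

theorem exists_primitive {R : Type*} [CommRing R] [IsDomain R] [ValuationRing R] {σ : Type*}
    (F : MvPolynomial σ R) (hF : F ≠ 0) :
    ∃ (s : σ →₀ ℕ) (F1 : MvPolynomial σ R), F = MvPolynomial.C (F.coeff s) * F1 ∧ F1.coeff s = 1 := by
  classical
  have key : ∀ T : Finset (σ →₀ ℕ), T.Nonempty → ∃ s ∈ T, ∀ t ∈ T, F.coeff s ∣ F.coeff t := by
    intro T hT
    induction hT using Finset.Nonempty.cons_induction with
    | singleton a => exact ⟨a, by simp, by simp⟩
    | cons a T ha hT ih =>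
      obtain ⟨s, hs, h⟩ := ih
      rcases ValuationRing.dvd_total (F.coeff s) (F.coeff a) with h1 | h1
      · refine ⟨s, by simp [hs], ?_⟩
        intro t ht
        rcases Finset.mem_cons.1 ht with rfl | ht
        · exact h1
        · exact h t ht
      · refine ⟨a, by simp, ?_⟩
        intro t ht
        rcases Finset.mem_cons.1 ht with rfl | ht
        · exact dvd_rfl
        · exact h1.trans (h t ht)
  obtain ⟨s, hs, h⟩ := key F.support (by simpa [Finset.nonempty_iff_ne_empty] using hF)
  have hs0 : F.coeff s ≠ 0 := by simpa using hs
  have hd : MvPolynomial.C (F.coeff s) ∣ F := by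
    rw [MvPolynomial.C_dvd_iff_dvd_coeff]
    intro t
    by_cases ht : t ∈ F.support
    · exact h t ht
    · rw [MvPolynomial.notMem_support_iff.1 ht]; exact dvd_zero _
  obtain ⟨F1, hF1⟩ := hd
  refine ⟨s, F1, hF1, ?_⟩
  have := congrArg (MvPolynomial.coeff s) hF1
  rw [MvPolynomial.coeff_C_mul] at this
  exact mul_left_cancel₀ hs0 (by rw [← this, mul_one])

section
variable {R O L L' : Type*} [CommRing R] [CommRing O] [CommRing L] [CommRing L']

theorem map_eq_zero_iff_ker {σ : Type*} (ρ : R →+* O) (F : MvPolynomial σ R) :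
    F.map ρ = 0 ↔ ∀ s, F.coeff s ∈ RingHom.ker ρ := by
  rw [MvPolynomial.ext_iff]
  simp [MvPolynomial.coeff_map, RingHom.mem_ker]

theorem Indep.lift [IsDomain R] [ValuationRing R] [IsDomain O] [Nontrivial L']
    (ρ : R →+* O) (ψ : O →+* L') {a : ℕ} (x : Fin a → O) (h : Indep (ψ.comp ρ) (fun i => ψ (x i))) :
    Indep ρ x := by
  intro F hF
  by_contra hne
  have hF0 : F ≠ 0 := by rintro rfl; simp at hne
  obtain ⟨s, F1, h1, h2⟩ := exists_primitive F hF0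
  have hc : ρ (F.coeff s) ≠ 0 := by
    intro h0
    apply hne
    rw [h1]; simp [h0]
  rw [h1, MvPolynomial.eval₂_mul, MvPolynomial.eval₂_C] at hF
  have h3 : F1.eval₂ ρ x = 0 := (mul_eq_zero.1 hF).resolve_left hc
  have h4 : F1.eval₂ (ψ.comp ρ) (fun i => ψ (x i)) = 0 := by
    have := congrArg ψ h3
    rw [MvPolynomial.eval₂_comp_left, map_zero] at this
    exact this
  have h5 := (map_eq_zero_iff_ker _ _).1 (h F1 h4) s
  rw [h2, RingHom.mem_ker, map_one] at h5
  exact one_ne_zero h5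

theorem Indep.inj (ρ : R →+* O) (ι : O →+* L) (hι : Function.Injective ι) {a : ℕ} (x : Fin a → O)
    (h : Indep ρ x) : Indep (ι.comp ρ) (fun i => ι (x i)) := by
  intro F hF
  have h1 : F.eval₂ ρ x = 0 := by
    apply hι
    rw [MvPolynomial.eval₂_comp_left, map_zero]
    exact hF
  rw [← MvPolynomial.map_map, h F h1, map_zero]

theorem Pot.inj (ρ : R →+* O) (ι : O →+* L) (hι : Function.Injective ι) {N : ℕ}
    (h : Pot ρ N) : Pot (ι.comp ρ) N := by
  obtain ⟨a, l, h1, ⟨x, hx⟩, h2⟩ := h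
  refine ⟨a, l, h1, ⟨_, hx.inj ρ ι hι x⟩, ?_⟩
  intro r hr
  apply h2
  rw [RingHom.mem_ker] at hr ⊢
  exact hι (by rw [map_zero]; exact hr)

theorem Pot.step_le [IsDomain R] [ValuationRing R] [IsDomain O] [Nontrivial L']
    (ρ : R →+* O) (ψ : O →+* L') (hψ : Function.Surjective ψ) {N : ℕ}
    (h : Pot (ψ.comp ρ) N) : Pot ρ N := by
  obtain ⟨a, l, h1, ⟨x, hx⟩, h2⟩ := h
  choose y hy using fun i => hψ (x i)
  have : x = fun i => ψ (y i) := by ext i; exact (hy i).symm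
  rw [this] at hx
  refine ⟨a, l, h1, ⟨y, hx.lift⟩, ?_⟩
  intro r hr
  apply h2
  rw [RingHom.mem_ker] at hr ⊢
  simp [hr]

theorem trailing_mem [IsDomain O] (ψ : O →+* L') (H : O[X]) (z : O) (hz : z ≠ 0)
    (hψz : ψ z = 0) (hH : H.eval z = 0) : ψ H.trailingCoeff = 0 := by
  have : X ^ H.natTrailingDegree ∣ H := by
    rw [X_pow_dvd_iff]
    intro d hd
    exact coeff_eq_zero_of_lt_natTrailingDegree hd
  obtain ⟨G, hG⟩ := this
  have h0 : H.trailingCoeff = G.coeff 0 := by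
    rw [trailingCoeff]
    conv_lhs => rw [hG]
    have := coeff_X_pow_mul G H.natTrailingDegree 0
    rw [zero_add] at this
    rw [← hG] at this ⊢
    exact this
  rw [h0]
  rw [hG, eval_mul, eval_pow, eval_X] at hH
  have h1 := (mul_eq_zero.1 hH).resolve_left (pow_ne_zero _ hz)
  have h2 : ψ (G.eval z) = 0 := by rw [h1, map_zero]
  rw [← eval_map_apply, hψz, ← coeff_zero_eq_eval_zero, coeff_map] at h2
  exact h2

theorem Pot.step_lt [IsDomain R] [ValuationRing R] [IsDomain O] [IsDomain L']
    (ρ : R →+* O) (ψ : O →+* L') (hψ : Function.Surjective ψ) (z : O) (hz : z ≠ 0)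
    (hψz : ψ z = 0) {N : ℕ}
    (h : Pot (ψ.comp ρ) N) : Pot ρ (N + 1) := by
  obtain ⟨a, l, h1, ⟨x, hx⟩, h2⟩ := h
  choose y hy using fun i => hψ (x i)
  have : x = fun i => ψ (y i) := by ext i; exact (hy i).symm
  rw [this] at hx
  have hle : RingHom.ker ρ ≤ RingHom.ker (ψ.comp ρ) := by
    intro r hr
    rw [RingHom.mem_ker] at hr ⊢
    simp [hr]
  by_cases hk : RingHom.ker (ψ.comp ρ) = RingHom.ker ρ
  · refine ⟨a + 1, l, by omega, ⟨Fin.cons z y, ?_⟩, hle.trans h2⟩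
    intro F hF
    set G := MvPolynomial.finSuccEquiv R a F with hG
    set H : O[X] := G.map (MvPolynomial.eval₂Hom ρ y) with hH
    have hHz : H.eval z = 0 := by
      rw [← hF]
      have hh : ((evalRingHom z).comp ((mapRingHom (MvPolynomial.eval₂Hom ρ y)).comp
          (MvPolynomial.finSuccEquiv R a : MvPolynomial (Fin (a + 1)) R →+* _))) =
          MvPolynomial.eval₂Hom ρ (Fin.cons z y : Fin (a + 1) → O) := by
        apply MvPolynomial.ringHom_ext
        · intro r
          simp [MvPolynomial.finSuccEquiv_apply]
        · intro i
          refine Fin.cases ?_ (fun i => ?_) i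
          · simp [MvPolynomial.finSuccEquiv_X_zero]
          · simp [MvPolynomial.finSuccEquiv_X_succ]
      exact congrArg (fun q => q F) hh
    have hH0 : H = 0 := by
      by_contra hne
      apply trailingCoeff_nonzero_iff_nonzero.2 hne
      have ht := trailing_mem ψ H z hz hψz hHz
      set Gj := G.coeff H.natTrailingDegree
      have ht' : H.trailingCoeff = Gj.eval₂ ρ y := by
        rw [trailingCoeff, hH, coeff_map]; rfl
      rw [ht'] at ht ⊢
      rw [MvPolynomial.eval₂_comp_left] at ht
      have h3 := hx _ ht
      rw [map_eq_zero_iff_ker, hk, ← map_eq_zero_iff_ker] at h3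
      rw [MvPolynomial.eval₂_eq_eval_map, h3, map_zero]
    rw [map_eq_zero_iff_ker]
    intro s
    have h3 : MvPolynomial.map ρ (G.coeff (s 0)) = 0 := by
      apply hx.lift
      have := congrArg (fun p => p.coeff (s 0)) hH0
      simpa [hH] using this
    have h4 := (map_eq_zero_iff_ker _ _).1 h3 s.tail
    rw [hG, MvPolynomial.finSuccEquiv_coeff_coeff, Finsupp.cons_tail] at h4
    exact h4
  · have hlt : RingHom.ker ρ < l.head.asIdeal :=
      lt_of_lt_of_le (lt_of_le_of_ne hle (Ne.symm hk)) h2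
    refine ⟨a, l.cons ⟨RingHom.ker ρ, RingHom.ker_isPrime ρ⟩ ?_, ?_, ⟨y, hx.lift⟩, ?_⟩
    · exact hlt
    · simp; omega
    · simp

end
end S14
end PartD1

section PartD2
namespace S14
universe u

/-- every field point of `Λ` avoiding zeros on `U` has potential at least `e`. -/
def Good {R Λ : Type u} [CommRing R] [CommRing Λ] (ρ : R →+* Λ) (U : Set Λ) (e : ℕ) : Prop :=
  ∀ (L : Type u) [Field L] (φ : Λ →+* L), (∀ u ∈ U, φ u ≠ 0) → Pot (φ.comp ρ) e

theorem pot_zero {R L : Type*} [CommRing R] [CommRing L] [IsDomain L] (ρ : R →+* L) : Pot ρ 0 := by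
  refine ⟨0, RelSeries.singleton _ ⟨RingHom.ker ρ, RingHom.ker_isPrime ρ⟩, Nat.zero_le _,
    ⟨Fin.elim0, ?_⟩, ?_⟩
  · intro F hF
    obtain ⟨c, rfl⟩ := MvPolynomial.C_surjective (Fin 0) F
    simp at hF
    simp [hF]
  · exact le_rfl

theorem good_zero {R Λ : Type u} [CommRing R] [CommRing Λ] (ρ : R →+* Λ) (U : Set Λ) :
    Good ρ U 0 := fun _ _ _ _ => pot_zero _

/-- the valuation step. -/
theorem field_step {R Λ L : Type u} [CommRing R] [IsDomain R] [ValuationRing R] [CommRing Λ]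
    [Field L] (ρ : R →+* Λ) (φ : Λ →+* L) (A : Subring L) (hA : ∀ x, φ x ∈ A) (t : A)
    (ht0 : t ≠ 0) (ht : ¬ IsUnit t) (e : ℕ)
    (H : ∀ (L' : Type u) [Field L'] (χ : A →+* L'), Pot ((χ.comp (φ.codRestrict A hA)).comp ρ) e) :
    Pot (φ.comp ρ) (e + 1) := by
  obtain ⟨B, hAB, hB⟩ := Ideal.image_subset_nonunits_valuationSubring (Ideal.span {t})
    (by rwa [Ne, Ideal.span_singleton_eq_top])
  have htB : (t : L) ∈ B.nonunits := hB ⟨t, Ideal.mem_span_singleton_self _, rfl⟩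
  let j : A →+* B := Subring.inclusion hAB
  let ψ : B →+* IsLocalRing.ResidueField B := IsLocalRing.residue B
  have h1 := H _ (ψ.comp j)
  have h2 : Pot (j.comp ((φ.codRestrict A hA).comp ρ)) (e + 1) := by
    refine Pot.step_lt _ ψ IsLocalRing.residue_surjective (j t) ?_ ?_ h1
    · intro h
      apply ht0
      exact Subring.inclusion_injective hAB (h.trans (map_zero _).symm)
    · rw [IsLocalRing.residue_eq_zero_iff]
      have := (ValuationSubring.mem_nonunits_iff_exists_mem_maximalIdeal (A := B) (a := (t : L))).1 htB
      obtain ⟨h, h'⟩ := this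
      exact h'
  exact h2.inj _ B.subtype Subtype.val_injective

theorem good_poly {R Λ : Type u} [CommRing R] [IsDomain R] [ValuationRing R] [CommRing Λ]
    (ρ : R →+* Λ) (U : Submonoid Λ) (e : ℕ) (h : Good ρ U e) :
    Good ((C : Λ →+* Λ[X]).comp ρ) {p | p.leadingCoeff ∈ U} (e + 1) := by
  intro L _ φ hφ
  have hu : ∀ u ∈ U, φ (C u) ≠ 0 := fun u hu => hφ (C u) (by simpa using hu)
  have hy : φ X ≠ 0 := hφ X (by nontriviality Λ; simp [U.one_mem])
  set t : L := (φ X)⁻¹ with ht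
  let φ0 : Λ →+* L := φ.comp C
  let A : Subring L :=
    { carrier := {x | ∃ u ∈ U, ∃ q : Λ[X], φ0 u * x = q.eval₂ φ0 t}
      mul_mem' := by
        rintro x y ⟨u, hu, q, hq⟩ ⟨u', hu', q', hq'⟩
        refine ⟨u * u', U.mul_mem hu hu', q * q', ?_⟩
        rw [eval₂_mul, ← hq, ← hq', map_mul]; ring
      one_mem' := ⟨1, U.one_mem, 1, by simp⟩
      add_mem' := by
        rintro x y ⟨u, hu, q, hq⟩ ⟨u', hu', q', hq'⟩
        refine ⟨u * u', U.mul_mem hu hu', C u' * q + C u * q', ?_⟩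
        rw [eval₂_add, eval₂_mul, eval₂_mul, ← hq, ← hq', map_mul, eval₂_C, eval₂_C]; ring
      zero_mem' := ⟨1, U.one_mem, 0, by simp⟩
      neg_mem' := by
        rintro x ⟨u, hu, q, hq⟩
        exact ⟨u, hu, -q, by rw [eval₂_neg, ← hq]; ring⟩ }
  have hA : ∀ x, φ0 x ∈ A := fun x => ⟨1, U.one_mem, C x, by simp⟩
  have htA : t ∈ A := ⟨1, U.one_mem, X, by simp⟩
  have hinv : ∀ u ∈ U, (φ0 u)⁻¹ ∈ A := fun u hu' => ⟨u, hu', 1, by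
    rw [mul_inv_cancel₀ (show φ0 u ≠ 0 from hu u hu')]; simp⟩
  refine field_step ρ φ0 A hA ⟨t, htA⟩ ?_ ?_ e ?_
  · intro h0
    have : t = 0 := congrArg Subtype.val h0
    exact inv_ne_zero hy this
  · intro hun
    obtain ⟨⟨x, hx⟩, hx1⟩ := isUnit_iff_exists_inv.1 hun
    have hx2 : t * x = 1 := congrArg Subtype.val hx1
    obtain ⟨u, huU, q, hq⟩ := hx
    have hu0 : u ≠ 0 := by
      rintro rfl
      exact hu 0 huU (by simp)
    have : Nontrivial Λ := ⟨u, 0, hu0⟩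
    set N := q.natDegree with hN
    set p : Λ[X] := C u * X ^ (N + 1) - reflect N q with hp
    have hdeg : (reflect N q).degree < (C u * X ^ (N + 1)).degree := by
      rw [degree_C_mul_X_pow _ hu0]
      refine lt_of_le_of_lt (degree_le_of_natDegree_le (natDegree_reflect_le.trans (by simp [hN] : _ ≤ N))) ?_
      exact_mod_cast Nat.lt_succ_self N
    have hlc : p.leadingCoeff = u := by
      rw [hp, leadingCoeff_sub_of_degree_lt hdeg, leadingCoeff_C_mul_X_pow]
    refine hφ p (by simpa [hlc] using huU) ?_
    have hty : t * φ X = 1 := inv_mul_cancel₀ hy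
    let _inst : Invertible t := ⟨φ X, mul_inv_cancel₀ hy, hty⟩
    have h1 : eval₂ φ0 (φ X) (reflect N q) * t ^ N = eval₂ φ0 t q :=
      eval₂_reflect_mul_pow φ0 t N q le_rfl
    have h2 : eval₂ φ0 (φ X) (reflect N q) = φ (reflect N q) := by
      conv_rhs => rw [← eval₂_C_X (p := reflect N q)]
      rw [hom_eval₂]
    rw [h2, ← hq] at h1
    have hxy : x = φ X := by
      calc x = (t * φ X) * x := by rw [hty, one_mul]
        _ = (t * x) * φ X := by ring
        _ = φ X := by rw [hx2, one_mul]
    have h3 : φ (reflect N q) = φ0 u * φ X ^ (N + 1) := by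
      calc φ (reflect N q) = φ (reflect N q) * (t * φ X) ^ N := by rw [hty, one_pow, mul_one]
        _ = (φ (reflect N q) * t ^ N) * φ X ^ N := by rw [mul_pow]; ring
        _ = φ0 u * φ X ^ (N + 1) := by rw [h1, hxy]; ring
    rw [hp, map_sub, h3, map_mul, map_pow]
    exact sub_self _
  · intro L' _ χ
    refine h L' _ ?_
    intro u huU h0
    have : (χ ⟨_, hA u⟩) * χ ⟨_, hinv u huU⟩ = 1 := by
      rw [← map_mul]
      convert map_one χ
      exact Subtype.ext (mul_inv_cancel₀ (hu u huU))
    have h0' : χ ⟨_, hA u⟩ = 0 := h0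
    rw [h0', zero_mul] at this
    exact zero_ne_one this

end S14
end PartD2

section PartD3
namespace S14
universe u

/-- powers-of-`f`-inverted base. -/
theorem good_away {R : Type u} [CommRing R] [IsDomain R] [ValuationRing R] (f : R[X])
    (D : Type u) [CommRing D] [Algebra R[X] D] [IsLocalization.Away f D] :
    Good ((algebraMap R[X] D).comp C) {x | ∃ a : R[X], x = algebraMap R[X] D (1 + a * f)} 1 := by
  intro L _ φ hφ
  set φ0 : R[X] →+* L := φ.comp (algebraMap R[X] D) with hφ0
  have hf0 : φ0 f ≠ 0 := by
    have : IsUnit (φ0 f) := (IsLocalization.Away.algebraMap_isUnit (S := D) f).map φ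
    exact this.ne_zero
  refine field_step (C : R →+* R[X]) φ0 φ0.range (fun x => ⟨x, rfl⟩) ⟨φ0 f, f, rfl⟩ ?_ ?_ 0 ?_
  · intro h; exact hf0 (congrArg Subtype.val h)
  · intro h
    obtain ⟨⟨_, x, rfl⟩, hx1⟩ := isUnit_iff_exists_inv.1 h
    have hx2 : φ0 f * φ0 x = 1 := congrArg Subtype.val hx1
    apply hφ _ ⟨-x, rfl⟩
    show φ0 _ = 0
    simp only [map_add, map_one, map_mul, map_neg]
    rw [← hx2]; ring
  · intro L' _ χ
    exact pot_zero _

/-- Iterated leading coefficient monoid. -/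
noncomputable def LM {Λ : Type u} [CommRing Λ] [IsDomain Λ] (U : Submonoid Λ) :
    (n : ℕ) → Submonoid (MvPolynomial (Fin n) Λ)
  | 0 => U.map (MvPolynomial.C : Λ →+* MvPolynomial (Fin 0) Λ)
  | n + 1 => ((LM U n).comap (leadingCoeffHom : (MvPolynomial (Fin n) Λ)[X] →* _)).comap
      (MvPolynomial.finSuccEquiv Λ n : MvPolynomial (Fin (n + 1)) Λ →* _)

theorem mem_LM_succ {Λ : Type u} [CommRing Λ] [IsDomain Λ] (U : Submonoid Λ) (n : ℕ)
    (p : MvPolynomial (Fin (n + 1)) Λ) :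
    p ∈ LM U (n + 1) ↔ (MvPolynomial.finSuccEquiv Λ n p).leadingCoeff ∈ LM U n := Iff.rfl

theorem zero_notMem_LM {Λ : Type u} [CommRing Λ] [IsDomain Λ] (U : Submonoid Λ) (hU : (0 : Λ) ∉ U) :
    ∀ n, (0 : MvPolynomial (Fin n) Λ) ∉ LM U n
  | 0 => by
    rintro ⟨u, hu, h⟩
    apply hU
    have : u = 0 := by
      apply MvPolynomial.C_injective (Fin 0) Λ
      rw [map_zero]; exact h
    rwa [← this]
  | n + 1 => by
    rw [mem_LM_succ, map_zero, leadingCoeff_zero]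
    exact zero_notMem_LM U hU n

theorem good_LM {R Λ : Type u} [CommRing R] [IsDomain R] [ValuationRing R] [CommRing Λ] [IsDomain Λ]
    (ρ : R →+* Λ) (U : Submonoid Λ) (e : ℕ) (h : Good ρ U e) :
    ∀ n, Good ((MvPolynomial.C : Λ →+* MvPolynomial (Fin n) Λ).comp ρ) (LM U n) (e + n)
  | 0 => by
    intro L _ φ hφ
    exact h L (φ.comp MvPolynomial.C) (fun u hu => hφ _ ⟨u, hu, rfl⟩)
  | n + 1 => by
    intro L _ φ hφ
    have := good_poly _ (LM U n) (e + n) (good_LM ρ U e h n) L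
      (φ.comp ((MvPolynomial.finSuccEquiv Λ n).symm : _ →+* _)) (by
        intro p hp
        apply hφ
        show _ ∈ LM U (n + 1)
        rw [mem_LM_succ]
        simpa using hp)
    convert this using 1
    ext r
    simp only [RingHom.comp_apply]
    congr 1
    rw [RingHom.coe_coe, AlgEquiv.eq_symm_apply]
    · simp [MvPolynomial.finSuccEquiv_apply]
    · rfl

theorem pot_series {R C : Type u} [CommRing R] [IsDomain R] [ValuationRing R] [CommRing C]
    (ρ : R →+* C) (N : ℕ)
    (H : ∀ (L : Type u) [Field L] (φ : C →+* L), Pot (φ.comp ρ) N) :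
    ∀ (k : ℕ) (l : LTSeries (PrimeSpectrum C)), l.length = k →
      Pot ((Ideal.Quotient.mk l.head.asIdeal).comp ρ) (N + k) := by
  intro k
  induction k with
  | zero =>
    intro l hl
    obtain ⟨M, hM, hle⟩ := Ideal.exists_le_maximal l.head.asIdeal l.head.2.ne_top
    let _ := Ideal.Quotient.field M
    have := H (C ⧸ M) (Ideal.Quotient.mk M)
    exact Pot.step_le _ (Ideal.Quotient.factor hle) (Ideal.Quotient.factor_surjective hle) this
  | succ k ih =>
    intro l hl
    have hl0 : l.length ≠ 0 := by omega
    have := ih (l.tail hl0) (by simp [hl])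
    have hlt : l.head < (l.tail hl0).head := by
      rw [RelSeries.head_tail]
      have := l.step ⟨0, by omega⟩
      have h1 : (1 : Fin (l.length + 1)) = Fin.succ ⟨0, by omega⟩ := by
        apply Fin.ext
        rw [Fin.val_one', Fin.val_succ]
        exact Nat.mod_eq_of_lt (by omega)
      rw [h1]
      exact this
    rw [← PrimeSpectrum.asIdeal_lt_asIdeal] at hlt
    obtain ⟨z, hz1, hz2⟩ := SetLike.exists_of_lt hlt
    refine Pot.step_lt _ (Ideal.Quotient.factor hlt.le) (Ideal.Quotient.factor_surjective hlt.le)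
      (Ideal.Quotient.mk _ z) ?_ ?_ this
    · rwa [Ne, Ideal.Quotient.eq_zero_iff_mem]
    · rw [Ideal.Quotient.factor_mk, Ideal.Quotient.eq_zero_iff_mem]
      exact hz1

theorem dim_le_of_pot {R C : Type u} [CommRing R] [IsDomain R] [ValuationRing R] [CommRing C]
    [IsDomain C] (ρ : R →+* C) (N d : ℕ) (hd : ringKrullDim R ≤ d)
    (H : ∀ (L : Type u) [Field L] (φ : C →+* L), Pot (φ.comp ρ) N)
    (H2 : ∀ (a : ℕ) (x : Fin a → C), Indep ρ x → a ≤ N) : ringKrullDim C ≤ d := by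
  refine iSup_le ?_
  intro l
  have h1 := pot_series ρ N H l.length l rfl
  obtain ⟨a, l', h2, ⟨x, hx⟩, -⟩ := Pot.step_le _ _ Ideal.Quotient.mk_surjective h1
  have h3 := H2 a x hx
  have h4 : (l'.length : WithBot ℕ∞) ≤ d := (Order.LTSeries.length_le_krullDim l').trans hd
  have h5 : l'.length ≤ d := by exact_mod_cast h4
  have : l.length ≤ d := by omega
  exact_mod_cast this

end S14
end PartD3

section PartD4
namespace S14
universe u

theorem dim_LM {R Λ : Type u} [CommRing R] [IsDomain R] [ValuationRing R] [CommRing Λ] [IsDomain Λ]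
    [Algebra R Λ] [FaithfulSMul R Λ] (d : ℕ) (hd : ringKrullDim R ≤ d) (e : ℕ)
    (htr : Algebra.trdeg R Λ = e) (U : Submonoid Λ) (hU : (0 : Λ) ∉ U)
    (h : Good (algebraMap R Λ) U e) (n : ℕ) :
    ringKrullDim (Localization (LM U n)) ≤ d := by
  have hle : LM U n ≤ nonZeroDivisors _ := by
    intro x hx
    rw [mem_nonZeroDivisors_iff_ne_zero]
    rintro rfl
    exact zero_notMem_LM U hU n hx
  set P := MvPolynomial (Fin n) Λ with hP
  set T := Localization (LM U n) with hT
  have hTd : IsDomain T := IsLocalization.isDomain_localization hle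
  have hinj : Function.Injective (algebraMap P T) := IsLocalization.injective _ hle
  have f1 : FaithfulSMul P T := (faithfulSMul_iff_algebraMap_injective _ _).2 hinj
  have f2 : FaithfulSMul R P := (faithfulSMul_iff_algebraMap_injective _ _).2 (by
    rw [IsScalarTower.algebraMap_eq R Λ P]
    exact (MvPolynomial.C_injective _ _).comp (FaithfulSMul.algebraMap_injective R Λ))
  have hinjRT : Function.Injective (algebraMap R T) := by
    rw [IsScalarTower.algebraMap_eq R P T]
    exact hinj.comp (FaithfulSMul.algebraMap_injective R P)
  refine dim_le_of_pot (algebraMap R T) (e + n) d hd ?_ ?_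
  · intro L _ φ
    have := good_LM (algebraMap R Λ) U e h n L (φ.comp (algebraMap P T)) (by
      intro u hu
      have : IsUnit (algebraMap P T u) := IsLocalization.map_units T ⟨u, hu⟩
      exact (this.map φ).ne_zero)
    convert this using 1
    rw [RingHom.comp_assoc, IsScalarTower.algebraMap_eq R P T]
    rfl
  · intro a x hx
    have hai : AlgebraicIndependent R x := by
      rw [algebraicIndependent_iff]
      intro F hF
      have := hx F hF
      exact MvPolynomial.map_injective _ hinjRT (by rw [this, map_zero])
    have h1 := hai.lift_cardinalMk_le_trdeg
    have e1 : Algebra.trdeg P T = 0 := by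
      have : Algebra.IsAlgebraic P T := IsLocalization.isAlgebraic _ (LM U n)
      exact trdeg_eq_zero
    have e2 := trdeg_add_eq R P (A := T)
    have e3 := trdeg_add_eq R Λ (A := P)
    have e4 : Algebra.trdeg Λ P = n := (MvPolynomial.trdeg_of_isDomain (ι := Fin n) (S := Λ)).trans (by simp)
    rw [← e2, e1, ← e3, e4, htr] at h1
    simp at h1
    exact_mod_cast h1

end S14
end PartD4

section PartE1
namespace S14
universe u

theorem lc_shear {B : Type*} [CommRing B] [IsDomain B] (P : B[X][X]) (N : ℕ) (hN0 : N ≠ 0)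
    (hP : P.leadingCoeff ≠ 0) (hN : ∀ j, (P.coeff j).natDegree < N) :
    (P.eval₂ (mapRingHom (C : B →+* B[X])) (C X + X ^ N)).leadingCoeff =
      C P.leadingCoeff.leadingCoeff := by
  set m := P.natDegree with hm
  set q := P.leadingCoeff with hq
  have hmon : (X ^ N + C X : B[X][X]).Monic := monic_X_pow_add_C _ hN0
  have hnd : (X ^ N + C X : B[X][X]).natDegree = N := natDegree_X_pow_add_C
  have hCinj : Function.Injective (C : B →+* B[X]) := C_injective
  rw [eval₂_eq_sum_range, Finset.sum_range_succ, add_comm (C X)]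
  have hlow : ∑ j ∈ Finset.range m, mapRingHom (C : B →+* B[X]) (P.coeff j) * (X ^ N + C X) ^ j
      ∈ degreeLT B[X] (N * m) := by
    refine Submodule.sum_mem _ ?_
    intro j hj
    rw [Finset.mem_range] at hj
    rw [mem_degreeLT]
    by_cases h0 : P.coeff j = 0
    · rw [h0, map_zero, zero_mul, degree_zero]; exact WithBot.bot_lt_coe _
    rw [degree_mul, degree_eq_natDegree (hmon.pow j).ne_zero, hmon.natDegree_pow, hnd, coe_mapRingHom,
      degree_map_eq_of_injective hCinj, degree_eq_natDegree h0]
    have := hN j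
    have h2 : (P.coeff j).natDegree + j * N < N * m := by
      calc (P.coeff j).natDegree + j * N < N + j * N := by omega
        _ = N * (j + 1) := by ring
        _ ≤ N * m := Nat.mul_le_mul_left _ hj
    exact_mod_cast h2
  rw [mem_degreeLT] at hlow
  have hc : P.coeff m = q := rfl
  rw [hc]
  have htop : ((N * m : ℕ) : WithBot ℕ) ≤ (mapRingHom (C : B →+* B[X]) q * (X ^ N + C X) ^ m).degree := by
    rw [degree_mul, degree_eq_natDegree (hmon.pow m).ne_zero, hmon.natDegree_pow, hnd, coe_mapRingHom,
      degree_map_eq_of_injective hCinj, degree_eq_natDegree hP]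
    have : N * m ≤ q.natDegree + m * N := by rw [mul_comm]; omega
    exact_mod_cast this
  rw [leadingCoeff_add_of_degree_lt (lt_of_lt_of_le hlow htop),
    leadingCoeff_mul_monic (hmon.pow m), coe_mapRingHom, leadingCoeff_map_of_injective hCinj]

/-- shear automorphism -/
noncomputable def shear (B : Type*) [CommRing B] (N : ℕ) : B[X][X] ≃+* B[X][X] :=
  (taylorEquiv (X ^ N : B[X])).toRingEquiv.trans
    (Polynomial.Bivariate.swap (R := B)).toRingEquiv

theorem shear_apply {B : Type*} [CommRing B] (N : ℕ) (P : B[X][X]) :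
    shear B N P = P.eval₂ (mapRingHom (C : B →+* B[X])) (C X + X ^ N) := by
  have : (shear B N : B[X][X] →+* B[X][X]) =
      eval₂RingHom (mapRingHom (C : B →+* B[X])) (C X + X ^ N) := by
    apply Polynomial.ringHom_ext
    · intro a
      show Bivariate.swap (taylor (X ^ N) (C a)) = _
      rw [taylor_C, Bivariate.swap_C]
      simp
    · show Bivariate.swap (taylor (X ^ N) X) = _
      rw [taylor_X, map_add, Bivariate.swap_C]
      simp [Bivariate.swap_Y]
  exact congrArg (fun q => q P) this

theorem change_vars {Λ : Type u} [CommRing Λ] [IsDomain Λ] (U : Submonoid Λ) (hU : (0 : Λ) ∉ U) :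
    ∀ (n : ℕ) (h : MvPolynomial (Fin (n + 1)) Λ), h ∈ LM U (n + 1) →
    ∃ (θ : MvPolynomial (Fin (n + 1)) Λ ≃+* MvPolynomial (Fin (n + 1)) Λ) (g : Λ), g ∈ U ∧
      (MvPolynomial.finSuccEquiv Λ n (θ h)).leadingCoeff = MvPolynomial.C g := by
  intro n
  induction n with
  | zero =>
    intro h hh
    rw [mem_LM_succ] at hh
    obtain ⟨g, hg, e⟩ := hh
    exact ⟨RingEquiv.refl _, g, hg, e.symm⟩
  | succ n ih =>
    intro h hh
    rw [mem_LM_succ] at hh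
    obtain ⟨θ', g, hg, e⟩ := ih _ hh
    set p := MvPolynomial.finSuccEquiv Λ (n + 1) h with hp
    let F : MvPolynomial (Fin (n + 1)) Λ ≃+* (MvPolynomial (Fin n) Λ)[X] :=
      (MvPolynomial.finSuccEquiv Λ n).toRingEquiv
    let P := (p.map (θ' : MvPolynomial (Fin (n + 1)) Λ →+* MvPolynomial (Fin (n + 1)) Λ)).map
      (F : MvPolynomial (Fin (n + 1)) Λ →+* (MvPolynomial (Fin n) Λ)[X])
    have hlc : P.leadingCoeff = F (θ' p.leadingCoeff) := by
      rw [leadingCoeff_map_of_injective (RingEquiv.injective F),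
        leadingCoeff_map_of_injective (RingEquiv.injective θ')]
      rfl
    have hg0 : g ≠ 0 := by rintro rfl; exact hU hg
    have hlc2 : P.leadingCoeff.leadingCoeff = MvPolynomial.C g := by
      rw [hlc]; exact e
    have hP : P.leadingCoeff ≠ 0 := by
      intro h0
      rw [h0, leadingCoeff_zero, eq_comm, map_eq_zero_iff _ (MvPolynomial.C_injective _ _)] at hlc2
      exact hg0 hlc2
    obtain ⟨N, hN0, hN⟩ : ∃ N, N ≠ 0 ∧ ∀ j, (P.coeff j).natDegree < N := by
      refine ⟨P.support.sup (fun j => (P.coeff j).natDegree) + 1, Nat.succ_ne_zero _, ?_⟩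
      intro j
      by_cases hj : j ∈ P.support
      · exact Nat.lt_succ_of_le (Finset.le_sup (f := fun j => (P.coeff j).natDegree) hj)
      · rw [notMem_support_iff.1 hj]; simp
    have key := lc_shear P N hN0 hP hN
    rw [← shear_apply, hlc2] at key
    let G := (MvPolynomial.finSuccEquiv Λ (n + 1)).toRingEquiv
    refine ⟨((((G.trans (mapEquiv θ')).trans (mapEquiv F)).trans (shear _ N)).trans
      (mapEquiv F.symm)).trans G.symm, g, hg, ?_⟩
    have : MvPolynomial.finSuccEquiv Λ (n + 1) ((((((G.trans (mapEquiv θ')).trans (mapEquiv F)).trans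
      (shear _ N)).trans (mapEquiv F.symm)).trans G.symm) h) =
      (shear _ N P).map (F.symm : (MvPolynomial (Fin n) Λ)[X] →+* MvPolynomial (Fin (n + 1)) Λ) := by
      exact G.apply_symm_apply _
    rw [this, leadingCoeff_map_of_injective (RingEquiv.injective F.symm), key]
    show F.symm (C (MvPolynomial.C g)) = _
    rw [RingEquiv.symm_apply_eq]
    show _ = MvPolynomial.finSuccEquiv Λ n _
    simp [MvPolynomial.finSuccEquiv_apply]

end S14
end PartE1

section PartE2
namespace S14
universe u

theorem get_h {L : Type u} [CommRing L] (M : Submonoid L) (k : ℕ)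
    (hdim : ringKrullDim (Localization M) ≤ k) (v : Fin (k + 2) → L) (hv : Unim v) :
    ∃ w : Fin (k + 2) → L, Eqv v w ∧ ∃ h ∈ M, h ∈ Ideal.span (Set.range fun i : Fin (k+1) => w i.succ) := by
  have hd : ringKrullDim (Localization M) < ((k + 1 : ℕ) : WithBot ℕ∞) := by
    refine lt_of_le_of_lt hdim ?_
    exact_mod_cast Nat.lt_succ_self k
  have hsp : Ideal.span ({algebraMap L (Localization M) (v 0)} ∪
      Set.range (fun i : Fin (k + 1) => algebraMap L (Localization M) (v i.succ))) = ⊤ := by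
    obtain ⟨u, hu⟩ := hv
    rw [Ideal.eq_top_iff_one]
    have : (1 : Localization M) = algebraMap L _ (v ⬝ᵥ u) := by rw [hu, map_one]
    rw [this, dotProduct, Fin.sum_univ_succ, map_add, map_sum, map_mul]
    refine Ideal.add_mem _ (Ideal.mul_mem_right _ _ (Ideal.subset_span (Or.inl rfl))) ?_
    refine Ideal.sum_mem _ fun i _ => ?_
    rw [map_mul]
    exact Ideal.mul_mem_right _ _ (Ideal.subset_span (Or.inr ⟨i, rfl⟩))
  obtain ⟨c, hc⟩ := stable_range (k + 1) hd (algebraMap L (Localization M)) (by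
    intro a
    obtain ⟨⟨x, s⟩, hx⟩ := IsLocalization.surj M a
    refine ⟨x, (IsLocalization.map_units (Localization M) s).unit⁻¹, ?_⟩
    rw [Units.eq_mul_inv_iff_mul_eq]
    exact hx) (v 0) (fun i => v i.succ) hsp
  refine ⟨_, eqv_add_mul_zero v c, ?_⟩
  simp only [Fin.cons_succ]
  have h1 : (1 : Localization M) ∈ Ideal.map (algebraMap L (Localization M))
      (Ideal.span (Set.range fun i : Fin (k+1) => v i.succ + c i * v 0)) := by
    rw [Ideal.map_span, ← Set.range_comp]
    simp only [Function.comp_def]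
    rw [hc]; trivial
  rw [IsLocalization.mem_map_algebraMap_iff M] at h1
  obtain ⟨⟨x, s⟩, hx⟩ := h1
  rw [one_mul] at hx
  obtain ⟨t, ht⟩ := (IsLocalization.eq_iff_exists M _).1 hx
  refine ⟨t * s, (t * s).2, ?_⟩
  have ht' : (t : L) * s = t * x := ht
  rw [ht']
  exact Ideal.mul_mem_left _ _ x.2

theorem make_lc {Λ : Type u} [CommRing Λ] [IsDomain Λ] (U : Submonoid Λ) (hU : (0 : Λ) ∉ U)
    (n k : ℕ) (hdim : ringKrullDim (Localization (LM U (n + 1))) ≤ k)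
    (v : Fin (k + 2) → MvPolynomial (Fin (n + 1)) Λ) (hv : Unim v) :
    ∃ (e : MvPolynomial (Fin (n + 1)) Λ ≃+* (MvPolynomial (Fin n) Λ)[X]) (g : Λ)
      (w : Fin (k + 2) → (MvPolynomial (Fin n) Λ)[X]), g ∈ U ∧ Eqv (fun i => e (v i)) w ∧
      (w 0).leadingCoeff = MvPolynomial.C g := by
  obtain ⟨w, hvw, h, hh, hmem⟩ := get_h _ k hdim v hv
  obtain ⟨θ, g, hg, hlc⟩ := change_vars U hU n h hh
  let e : MvPolynomial (Fin (n + 1)) Λ ≃+* (MvPolynomial (Fin n) Λ)[X] :=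
    θ.trans (MvPolynomial.finSuccEquiv Λ n).toRingEquiv
  have hlc : (e h).leadingCoeff = MvPolynomial.C g := hlc
  have hg0 : g ≠ 0 := by rintro rfl; exact hU hg
  have he0 : e h ≠ 0 := by
    intro h0
    rw [h0, leadingCoeff_zero, eq_comm, map_eq_zero_iff _ (MvPolynomial.C_injective _ _)] at hlc
    exact hg0 hlc
  obtain ⟨c, hc⟩ := Ideal.mem_span_range_iff_exists_fun.1 hmem
  let N := (e (w 0)).natDegree + 1
  have hE := (hvw.map (e : MvPolynomial (Fin (n + 1)) Λ →+* (MvPolynomial (Fin n) Λ)[X])).trans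
    (eqv_zero_add (fun i => e (w i)) (fun i => X ^ N * e (c i)))
  refine ⟨e, g, _, hg, hE, ?_⟩
  rw [Fin.cons_zero]
  have : ∑ i, X ^ N * e (c i) * e (w i.succ) = X ^ N * e h := by
    rw [← hc, map_sum, Finset.mul_sum]
    simp only [map_mul, mul_assoc]
  rw [this, leadingCoeff_add_of_degree_lt, leadingCoeff_monic_mul (monic_X_pow N), hlc]
  rw [degree_mul, degree_X_pow, degree_eq_natDegree he0]
  refine lt_of_le_of_lt degree_le_natDegree ?_
  have : (e (w 0)).natDegree < N + (e h).natDegree := by simp only [N]; omega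
  exact_mod_cast this

/-- the standard row -/
def e1 (A : Type*) [CommRing A] (k : ℕ) : Fin (k + 2) → A := Fin.cons 1 (fun _ => 0)

theorem e1_map {A B : Type*} [CommRing A] [CommRing B] (φ : A →+* B) (k : ℕ) :
    (fun i => φ (e1 A k i)) = e1 B k := by
  funext i
  refine Fin.cases ?_ (fun j => ?_) i <;> simp [e1]

def Triv (A : Type*) [CommRing A] (k : ℕ) : Prop :=
  ∀ v : Fin (k + 2) → A, Unim v → Eqv v (e1 A k)

theorem Triv.equiv {A B : Type*} [CommRing A] [CommRing B] {k : ℕ} (h : Triv A k) (e : A ≃+* B) :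
    Triv B k := by
  intro v hv
  have h1 := (h _ (hv.map (e.symm : B →+* A))).map (e : A →+* B)
  rw [e1_map] at h1
  simpa using h1

theorem eqv_of_isUnit {A : Type*} [CommRing A] {k : ℕ} (v : Fin (k + 2) → A) (h : IsUnit (v 0)) :
    Eqv v (e1 A k) := by
  obtain ⟨u, hu⟩ := h
  have h1 := eqv_add_mul_zero v (fun i => - v i.succ * (u⁻¹ : Aˣ))
  refine h1.trans ?_
  have h2 := eqv_smul_unit (Fin.cons (v 0) (fun i => v i.succ + (- v i.succ * (u⁻¹ : Aˣ)) * v 0))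
    (Fin.cons (u⁻¹) (fun _ => 1))
  convert h2 using 1
  funext i
  refine Fin.cases ?_ (fun j => ?_) i
  · simp [e1, ← hu]
  · simp [e1, ← hu]

theorem triv_local (A : Type*) [CommRing A] [IsLocalRing A] (k : ℕ) : Triv A k := by
  intro v hv
  by_cases h0 : IsUnit (v 0)
  · exact eqv_of_isUnit v h0
  obtain ⟨j, hj⟩ : ∃ j : Fin (k + 1), IsUnit (v j.succ) := by
    by_contra! hcon
    obtain ⟨u, hu⟩ := hv
    have : (1 : A) ∈ IsLocalRing.maximalIdeal A := by
      rw [← hu, dotProduct, Fin.sum_univ_succ]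
      refine Ideal.add_mem _ (Ideal.mul_mem_right _ _ h0) (Ideal.sum_mem _ fun i _ =>
        Ideal.mul_mem_right _ _ (hcon i))
    exact this isUnit_one
  refine (eqv_zero_add v (Pi.single j 1)).trans (eqv_of_isUnit _ ?_)
  rw [Fin.cons_zero]
  have : ∑ i, (Pi.single j 1 : Fin (k+1) → A) i * v i.succ = v j.succ := by
    simp [Pi.single_apply]
  rw [this]
  by_contra hn
  apply (IsLocalRing.maximalIdeal A).sub_mem (a := v 0 + v j.succ) (b := v 0) hn h0
  simpa using hj

/-- Theorem V. -/
theorem triv_V (R : Type u) [CommRing R] [IsDomain R] [ValuationRing R] (d : ℕ)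
    (hd : ringKrullDim R ≤ d) (k : ℕ) (hk : d ≤ k) (n : ℕ) :
    Triv (MvPolynomial (Fin n) R) k := by
  induction n with
  | zero =>
    exact (triv_local R k).equiv (MvPolynomial.isEmptyRingEquiv R (Fin 0)).symm
  | succ n ih =>
    intro v hv
    have h0 : (0 : R) ∉ (⊥ : Submonoid R) := by simp
    have hdim := dim_LM (R := R) (Λ := R) d hd 0 (by simpa using trdeg_eq_zero) ⊥ h0
      (good_zero _ _) (n + 1)
    obtain ⟨e, g, w, hg, hw, hlc⟩ := make_lc ⊥ h0 n k (hdim.trans (by exact_mod_cast hk)) v hv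
    have hg : g = 1 := by simpa using hg
    have hwu : Unim w := hw.unim
      (hv.map (e : MvPolynomial (Fin (n + 1)) R →+* (MvPolynomial (Fin n) R)[X]))
    have h1 := lc_mem_radical w hwu
    rw [hlc, hg, map_one, ← Ideal.eq_top_iff_one, Ideal.radical_eq_top] at h1
    have h2 : (1 : MvPolynomial (Fin n) R) ∈ Iv w := by rw [h1]; trivial
    have h3 := (mem_Iv.1 h2 X (-X)).symm
    simp only [map_one, one_mul, add_neg_cancel, comp_X, comp_zero] at h3
    have h4 := (ih _ (hwu.map (evalRingHom 0))).map C
    rw [e1_map] at h4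
    have h5 := ((hw.trans h3).trans h4).map (e.symm : (MvPolynomial (Fin n) R)[X] →+* MvPolynomial (Fin (n + 1)) R)
    rw [e1_map] at h5
    simpa using h5

end S14
end PartE2

section PartE3
namespace S14
universe u

structure IsAway {B C : Type*} [CommRing B] [CommRing C] (φ : B →+* C) (f : B) : Prop where
  inj : Function.Injective φ
  unit : IsUnit (φ f)
  surj : ∀ c, ∃ (N : ℕ) (b : B), φ f ^ N * c = φ b

section
variable {B C : Type*} [CommRing B] [CommRing C] {φ : B →+* C} {f : B}

theorem IsAway.poly (h : IsAway φ f) : IsAway (mapRingHom φ) (Polynomial.C f) where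
  inj := map_injective _ h.inj
  unit := by
    rw [coe_mapRingHom, map_C]
    exact h.unit.map Polynomial.C
  surj := by
    intro c
    induction c using Polynomial.induction_on' with
    | add p q hp hq =>
      obtain ⟨N, b, hb⟩ := hp
      obtain ⟨N', b', hb'⟩ := hq
      refine ⟨N + N', Polynomial.C f ^ N' * b + Polynomial.C f ^ N * b', ?_⟩
      rw [map_add, map_mul, map_mul, ← hb, ← hb', map_pow, map_pow]
      ring
    | monomial n a =>
      obtain ⟨N, b, hb⟩ := h.surj a
      refine ⟨N, monomial n b, ?_⟩
      rw [coe_mapRingHom, map_C, map_monomial, ← hb, ← C_pow, C_mul_monomial]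

theorem IsAway.mv (h : IsAway φ f) (σ : Type*) :
    IsAway (MvPolynomial.map (σ := σ) φ) (MvPolynomial.C f) where
  inj := MvPolynomial.map_injective _ h.inj
  unit := by
    rw [MvPolynomial.map_C]
    exact h.unit.map MvPolynomial.C
  surj := by
    intro c
    induction c using MvPolynomial.induction_on' with
    | add p q hp hq =>
      obtain ⟨N, b, hb⟩ := hp
      obtain ⟨N', b', hb'⟩ := hq
      refine ⟨N + N', MvPolynomial.C f ^ N' * b + MvPolynomial.C f ^ N * b', ?_⟩
      rw [map_add, map_mul, map_mul, ← hb, ← hb', map_pow, map_pow]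
      ring
    | monomial n a =>
      obtain ⟨N, b, hb⟩ := h.surj a
      refine ⟨N, MvPolynomial.monomial n b, ?_⟩
      rw [MvPolynomial.map_C, MvPolynomial.map_monomial, ← hb, ← map_pow,
        MvPolynomial.C_mul_monomial]

theorem IsAway.surj_fin (h : IsAway φ f) {m : ℕ} (c : Fin m → C) :
    ∃ (N : ℕ) (b : Fin m → B), ∀ i, φ f ^ N * c i = φ (b i) := by
  choose N b hb using fun i => h.surj (c i)
  refine ⟨∑ j, N j, fun i => f ^ (∑ j, N j - N i) * b i, fun i => ?_⟩
  rw [map_mul, ← hb, ← mul_assoc, map_pow, ← pow_add,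
    Nat.sub_add_cancel (Finset.single_le_sum (fun _ _ => Nat.zero_le _) (Finset.mem_univ i))]

theorem IsAway.descend (h : IsAway φ f) {k : ℕ} (hB : Triv B k) (w : Fin (k + 2) → C)
    (hw : Unim w) (a : B) (h0 : w 0 = φ (1 + a * f)) : Eqv w (e1 C k) := by
  obtain ⟨N, b, hb⟩ := h.surj_fin (fun i : Fin (k + 1) => w i.succ)
  let u : Fin (k + 2) → B := Fin.cons (1 + a * f) b
  have hE : Eqv w (fun i => φ (u i)) := by
    convert eqv_smul_unit w (Fin.cons 1 (fun _ => h.unit.unit ^ N)) using 1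
    funext i
    refine Fin.cases ?_ (fun j => ?_) i
    · simp [u, h0]
    · simp [u, ← hb, mul_comm]
  have hu : Unim u := by
    obtain ⟨x, hx⟩ := hE.unim hw
    obtain ⟨N', y, hy⟩ := h.surj_fin x
    have h1 : u ⬝ᵥ y = f ^ N' := by
      apply h.inj
      have := congrArg (fun t => φ f ^ N' * t) hx
      simp only [mul_one] at this
      rw [map_pow, ← this, dotProduct, dotProduct, map_sum, Finset.mul_sum]
      refine Finset.sum_congr rfl fun i _ => ?_
      rw [map_mul, ← hy]; ring
    have hcop : IsCoprime (f ^ N') (1 + a * f) :=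
      IsCoprime.pow_left ⟨-a, 1, by ring⟩
    obtain ⟨α, β, hab⟩ := hcop
    refine ⟨α • y + β • (Fin.cons 1 (fun _ => 0)), ?_⟩
    rw [dotProduct_add, dotProduct_smul, dotProduct_smul, h1]
    have : u ⬝ᵥ (Fin.cons 1 (fun _ => 0)) = 1 + a * f := by
      simp [dotProduct, Fin.sum_univ_succ, u]
    rw [this]
    exact hab
  have := (hB u hu).map φ
  rw [e1_map] at this
  exact hE.trans this

theorem IsAway.step [IsDomain C] (h : IsAway φ f) {k : ℕ} (hB : Triv B[X] k) (hC : Triv C k)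
    (w : Fin (k + 2) → C[X]) (hw : Unim w) (a : B)
    (hlc : (w 0).leadingCoeff = φ (1 + a * f)) : Eqv w (e1 C[X] k) := by
  obtain ⟨K, hK⟩ := lc_mem_radical w hw
  rw [hlc, ← map_pow] at hK
  obtain ⟨G, hG⟩ := (hC _ (hw.map (evalRingHom 0))).symm.symm
  obtain ⟨w', hww', hw'0⟩ : ∃ w', Eqv w w' ∧ (w' 0).coeff 0 = 1 := by
    refine ⟨Matrix.vecMul w ((Polynomial.C : C →+* C[X]).mapMatrix G.1), ⟨Units.map
      ((Polynomial.C : C →+* C[X]).mapMatrix : Matrix (Fin (k+2)) (Fin (k+2)) C →+* _).toMonoidHom G,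
      rfl⟩, ?_⟩
    have := congrFun hG 0
    rw [coeff_zero_eq_eval_zero]
    simp only [e1, Fin.cons_zero] at this
    rw [← this]
    simp [Matrix.vecMul, dotProduct, eval_finset_sum]
  obtain ⟨q, hq⟩ : (X : C[X]) ∣ w' 0 - 1 := by
    rw [X_dvd_iff]; simp [hw'0]
  obtain ⟨m, q', hq'⟩ := h.poly.surj q
  have hcop : IsCoprime (f ^ (m + 1)) ((1 + a * f) ^ K) :=
      IsCoprime.pow ⟨-a, 1, by ring⟩
  obtain ⟨α, β, hab⟩ := hcop
  let y : B[X] := Polynomial.C (α * f ^ (m + 1)) * X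
  have hE := (mem_Iv.1 hK X (- (Polynomial.C (φ β) * X))).symm
  have hy : X + Polynomial.C (φ ((1 + a * f) ^ K)) * (- (Polynomial.C (φ β) * X)) =
      mapRingHom φ y := by
    have h2 : φ α * φ f ^ (m + 1) = 1 - φ β * φ ((1 + a * f) ^ K) := by
      have h3 := congrArg φ hab
      rw [map_add, map_mul, map_mul, map_one, map_pow φ f] at h3
      linear_combination h3
    simp only [y, coe_mapRingHom, Polynomial.map_mul, map_C, map_X, map_mul, map_pow] at h2 ⊢
    have h3 := congrArg Polynomial.C h2
    simp only [map_mul, map_pow, map_sub, map_one] at h3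
    rw [h3]; ring
  rw [hy] at hE
  simp only [comp_X] at hE
  have hE2 := hE.trans (hww'.map (compRingHom (mapRingHom φ y)))
  refine hE2.trans (h.poly.descend hB _ (hE2.unim hw) (Polynomial.C α * X * q'.comp y) ?_)
  have hw0 : w' 0 = 1 + X * q := by rw [← hq]; ring
  rw [hw0]
  have hq2 := congrArg (fun t => t.comp (mapRingHom φ y)) hq'
  simp only [coe_mapRingHom, map_C, mul_comp, pow_comp, C_comp] at hq2
  simp only [coe_compRingHom_apply, coe_mapRingHom, add_comp, one_comp, mul_comp, X_comp,
    Polynomial.map_add, Polynomial.map_one, Polynomial.map_mul, map_C, map_X, map_comp] at hq2 ⊢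
  have : (y.map φ) = Polynomial.C (φ α) * Polynomial.C (φ f) * Polynomial.C (φ f) ^ m * X := by
    simp only [y, Polynomial.map_mul, map_C, map_X, Polynomial.map_pow, C_mul, C_pow]; ring
  rw [← hq2]
  linear_combination (q.comp (y.map φ)) * this
end

end S14
end PartE3

section PartE4
namespace S14
universe u

theorem isAway_localization {B : Type*} [CommRing B] [IsDomain B] (f : B) (hf : f ≠ 0) (D : Type*)
    [CommRing D] [Algebra B D] [IsLocalization.Away f D] : IsAway (algebraMap B D) f where
  inj := IsLocalization.injective D (powers_le_nonZeroDivisors_of_noZeroDivisors hf)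
  unit := IsLocalization.Away.algebraMap_isUnit f
  surj := by
    intro c
    obtain ⟨N, b, hb⟩ := IsLocalization.Away.surj f c
    exact ⟨N, b, by rw [mul_comm]; exact hb⟩

/-- the monoid `1 + f B` pushed to `D` -/
def oneAdd {B D : Type*} [CommRing B] [CommRing D] [Algebra B D] (f : B) : Submonoid D where
  carrier := {x | ∃ a : B, x = algebraMap B D (1 + a * f)}
  one_mem' := ⟨0, by simp⟩
  mul_mem' := by
    rintro x y ⟨a, rfl⟩ ⟨b, rfl⟩
    exact ⟨a + b + a * b * f, by rw [← map_mul]; congr 1; ring⟩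

noncomputable def polyEquiv (R : Type*) [CommRing R] (n : ℕ) :
    MvPolynomial (Fin (n + 1)) R ≃ₐ[R] MvPolynomial (Fin n) R[X] :=
  (MvPolynomial.renameEquiv R (finSuccEquiv n)).trans (MvPolynomial.optionEquivRight R (Fin n))

theorem trdeg_away {R : Type u} [CommRing R] [IsDomain R] (f : R[X]) (hf : f ≠ 0) :
    Algebra.trdeg R (Localization.Away f) = 1 := by
  have : IsDomain (Localization.Away f) :=
    IsLocalization.isDomain_localization (powers_le_nonZeroDivisors_of_noZeroDivisors hf)
  have : FaithfulSMul R[X] (Localization.Away f) := by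
    rw [faithfulSMul_iff_algebraMap_injective]
    exact IsLocalization.injective _ (powers_le_nonZeroDivisors_of_noZeroDivisors hf)
  have : Algebra.IsAlgebraic R[X] (Localization.Away f) :=
    IsLocalization.isAlgebraic _ (Submonoid.powers f)
  have : FaithfulSMul R R[X] := inferInstance
  have h := trdeg_add_eq R R[X] (A := Localization.Away f)
  rw [Polynomial.trdeg_of_isDomain, trdeg_eq_zero, add_zero] at h
  exact h.symm

theorem make_lc' {Λ : Type u} [CommRing Λ] [IsDomain Λ] (U : Submonoid Λ) (hU : (0 : Λ) ∉ U)
    (n k : ℕ) (hdim : ringKrullDim (Localization (LM U (n + 1))) ≤ k)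
    (v : Fin (k + 2) → MvPolynomial (Fin (n + 1)) Λ) (hv : Unim v) :
    ∃ (g : Λ) (w : Fin (k + 2) → (MvPolynomial (Fin n) Λ)[X]), g ∈ U ∧ Unim w ∧
      (w 0).leadingCoeff = MvPolynomial.C g ∧ (Eqv w (e1 _ k) → Eqv v (e1 _ k)) := by
  obtain ⟨e, g, w, hg, hw, hlc⟩ := make_lc U hU n k hdim v hv
  refine ⟨g, w, hg, hw.unim (hv.map (e : MvPolynomial (Fin (n + 1)) Λ →+*
      (MvPolynomial (Fin n) Λ)[X])), hlc, fun h => ?_⟩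
  have h5 := (hw.trans h).map (e.symm : (MvPolynomial (Fin n) Λ)[X] →+*
      MvPolynomial (Fin (n + 1)) Λ)
  rw [e1_map] at h5
  simpa using h5

theorem triv_main (R : Type u) [CommRing R] [IsDomain R] [ValuationRing R] (d : ℕ)
    (hd : ringKrullDim R ≤ d) (k : ℕ) (hk : d ≤ k) (f : R[X]) (hf : f ≠ 0) (n : ℕ) :
    Triv (MvPolynomial (Fin n) (Localization.Away f)) k := by
  have hpoly : ∀ n, Triv (MvPolynomial (Fin n) R[X]) k := fun n =>
    (triv_V R d hd k hk (n + 1)).equiv (polyEquiv R n).toRingEquiv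
  have : IsDomain (Localization.Away f) :=
    IsLocalization.isDomain_localization (powers_le_nonZeroDivisors_of_noZeroDivisors hf)
  have hA : IsAway (algebraMap R[X] (Localization.Away f)) f := isAway_localization f hf _
  let U : Submonoid (Localization.Away f) := oneAdd f
  by_cases hU : (0 : Localization.Away f) ∈ U
  · obtain ⟨a, ha⟩ := hU
    rw [eq_comm, map_eq_zero_iff _ hA.inj] at ha
    have hs : Function.Surjective (algebraMap R[X] (Localization.Away f)) := by
      intro c
      obtain ⟨N, b, hb⟩ := hA.surj c
      refine ⟨(-a) ^ N * b, ?_⟩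
      rw [map_mul, ← hb, ← mul_assoc, ← map_pow, ← map_mul, ← mul_pow]
      have : -a * f = 1 := by linear_combination -ha
      rw [this]; simp
    exact (hpoly n).equiv (MvPolynomial.mapEquiv (Fin n) (RingEquiv.ofBijective _ ⟨hA.inj, hs⟩))
  have hinj : Function.Injective (algebraMap R (Localization.Away f)) := by
    rw [IsScalarTower.algebraMap_eq R R[X]]
    exact hA.inj.comp C_injective
  have : FaithfulSMul R (Localization.Away f) := by
    rwa [faithfulSMul_iff_algebraMap_injective]
  have hgood : Good (algebraMap R (Localization.Away f)) U 1 := by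
    rw [IsScalarTower.algebraMap_eq R R[X]]
    exact good_away f (Localization.Away f)
  have hdim : ∀ n, ringKrullDim (Localization (LM U n)) ≤ k := fun n =>
    (dim_LM d hd 1 (by rw [trdeg_away f hf]; simp) U hU hgood n).trans (by exact_mod_cast hk)
  induction n with
  | zero =>
    intro v hv
    obtain ⟨w, hvw, h, hh, hmem⟩ := get_h _ k (hdim 0) v hv
    obtain ⟨g, ⟨a, ha⟩, hg⟩ := hh
    let e := MvPolynomial.isEmptyRingEquiv (Localization.Away f) (Fin 0)
    obtain ⟨c, hc⟩ := Ideal.mem_span_range_iff_exists_fun.1 hmem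
    have h1 := hvw.map (e : MvPolynomial (Fin 0) (Localization.Away f) →+* Localization.Away f)
    have heh : e h = algebraMap _ _ (1 + a * f) := by
      rw [← ha, ← hg]
      exact e.apply_symm_apply g
    have hc' : ∑ i, e (c i) * e (w i.succ) = algebraMap _ _ (1 + a * f) := by
      rw [← heh, ← hc, map_sum]; simp only [map_mul]
    obtain ⟨N, b, hb⟩ := hA.surj (e (w 0))
    have h2 := h1.trans (eqv_smul_unit _ (Fin.cons (hA.unit.unit ^ N) (fun _ => 1)))
    have h3 := h2.trans (eqv_zero_add _ (fun i => algebraMap _ _ (1 - b) * e (c i)))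
    have hu := h3.unim (hv.map (e : MvPolynomial (Fin 0) (Localization.Away f) →+* Localization.Away f))
    have hB : Triv R[X] k := (hpoly 0).equiv (MvPolynomial.isEmptyRingEquiv R[X] (Fin 0))
    have h4 := h3.trans (hA.descend hB _ hu ((1 - b) * a) (by
      have : ∑ i, algebraMap _ _ (1 - b) * e (c i) * e (w i.succ) =
          algebraMap _ _ (1 - b) * algebraMap _ _ (1 + a * f) := by
        rw [← hc', Finset.mul_sum]; simp only [mul_assoc]
      simp only [Fin.cons_zero, Fin.cons_succ, RingHom.coe_coe, Units.val_one, mul_one, this]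
      rw [Units.val_pow_eq_pow_val, IsUnit.unit_spec, mul_comm _ (_ ^ N), hb, ← map_mul, ← map_add]
      congr 1; ring))
    have h5 := h4.map (e.symm : Localization.Away f →+* MvPolynomial (Fin 0) (Localization.Away f))
    rw [e1_map] at h5
    simpa using h5
  | succ n ih =>
    intro v hv
    obtain ⟨g, w, ⟨a, ha⟩, hwu, hlc, hback⟩ := make_lc' U hU n k (hdim (n + 1)) v hv
    have hB : Triv (MvPolynomial (Fin n) R[X])[X] k :=
      (hpoly (n + 1)).equiv (MvPolynomial.finSuccEquiv R[X] n).toRingEquiv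
    refine hback ((hA.mv (Fin n)).step hB ih w hwu (MvPolynomial.C a) ?_)
    rw [hlc, ha, ← MvPolynomial.C_1, ← MvPolynomial.C_mul, ← MvPolynomial.C_add,
        MvPolynomial.map_C]

end S14
end PartE4

section PartF
namespace S14

theorem cancel_one {A : Type*} [CommRing A] {k : ℕ} (hA : Triv A k) {Q : Type*} [AddCommGroup Q]
    [Module A Q] (e : (Q × A) ≃ₗ[A] (Fin (k + 2) → A)) : Nonempty (Q ≃ₗ[A] (Fin (k + 1) → A)) := by
  let π : (Fin (k + 2) → A) →ₗ[A] A := (LinearMap.snd A Q A).comp e.symm.toLinearMap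
  let v : Fin (k + 2) → A := fun i => π (Pi.single i 1)
  have hπ : ∀ x, π x = v ⬝ᵥ x := by
    intro x
    conv_lhs => rw [LinearMap.pi_apply_eq_sum_univ π x]
    simp only [dotProduct, v, smul_eq_mul]
    refine Finset.sum_congr rfl fun i _ => ?_
    rw [mul_comm]
    congr 2
    funext j
    simp [Pi.single_apply, eq_comm]
  have hv : Unim v := ⟨e (0, 1), by rw [← hπ]; simp [π]⟩
  obtain ⟨G, hG⟩ := hA v hv
  let T : (Fin (k + 2) → A) ≃ₗ[A] (Fin (k + 2) → A) :=
    LinearEquiv.ofLinear (Matrix.mulVecLin G.1) (Matrix.mulVecLin G⁻¹.1)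
      (by rw [← Matrix.mulVecLin_mul, Units.mul_inv, Matrix.mulVecLin_one])
      (by rw [← Matrix.mulVecLin_mul, Units.inv_mul, Matrix.mulVecLin_one])
  have hT : ∀ x, π (T x) = x 0 := by
    intro x
    rw [hπ]
    show v ⬝ᵥ (G.1.mulVec x) = _
    rw [Matrix.dotProduct_mulVec, hG]
    simp [e1, dotProduct, Fin.sum_univ_succ]
  let E : (Q × A) ≃ₗ[A] (Fin (k + 2) → A) := e.trans T.symm
  have hE : ∀ q, E q 0 = q.2 := by
    intro q
    have h := hT (E q)
    rw [← h]
    simp [E, π]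
  let ψ : Q →ₗ[A] (Fin (k + 1) → A) :=
    (LinearMap.funLeft A A Fin.succ).comp (E.toLinearMap.comp (LinearMap.inl A Q A))
  have hψ : ∀ q i, ψ q i = E (q, 0) i.succ := fun q i => rfl
  refine ⟨LinearEquiv.ofBijective ψ ⟨?_, ?_⟩⟩
  · rw [injective_iff_map_eq_zero]
    intro q hq
    have : E (q, 0) = 0 := by
      funext i
      refine Fin.cases ?_ (fun j => ?_) i
      · rw [hE]; rfl
      · rw [← hψ, hq]; rfl
    rw [LinearEquiv.map_eq_zero_iff] at this
    exact congrArg Prod.fst this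
  · intro y
    have h1 := hE (E.symm (Fin.cons 0 y))
    rw [LinearEquiv.apply_symm_apply, Fin.cons_zero] at h1
    refine ⟨(E.symm (Fin.cons 0 y)).1, ?_⟩
    funext i
    rw [hψ]
    have : ((E.symm (Fin.cons 0 y)).1, (0 : A)) = E.symm (Fin.cons 0 y) := Prod.ext rfl h1
    rw [this, LinearEquiv.apply_symm_apply, Fin.cons_succ]

theorem cancel {A : Type*} [CommRing A] {d : ℕ} (hA : ∀ k, d ≤ k → Triv A k) {P : Type*}
    [AddCommGroup P] [Module A P] (r : ℕ) (hr : d + 1 ≤ r) :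
    ∀ s : ℕ, Nonempty ((P × (Fin s → A)) ≃ₗ[A] (Fin (r + s) → A)) →
      Nonempty (P ≃ₗ[A] (Fin r → A)) := by
  obtain ⟨r, rfl⟩ : ∃ r', r = r' + 1 := ⟨r - 1, by omega⟩
  intro s
  induction s with
  | zero =>
    rintro ⟨e⟩
    exact ⟨(LinearEquiv.prodUnique (R := A) (M := P) (M₂ := Fin 0 → A)).symm.trans e⟩
  | succ s ih =>
    rintro ⟨e⟩
    apply ih
    let c : ((P × (Fin s → A)) × A) ≃ₗ[A] (P × (Fin (s + 1) → A)) :=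
      (LinearEquiv.prodAssoc A P (Fin s → A) A).trans
        ((LinearEquiv.refl A P).prodCongr ((LinearEquiv.prodComm A _ _).trans
          (Fin.consLinearEquiv A (fun _ : Fin (s + 1) => A))))
    obtain ⟨E⟩ := cancel_one (hA (r + s) (by omega)) ((c.trans e).trans
      (LinearEquiv.funCongrLeft A A (finCongr (show r + s + 2 = r + 1 + (s + 1) by omega))))
    exact ⟨E.trans (LinearEquiv.funCongrLeft A A (finCongr (show r + 1 + s = r + s + 1 by omega)))⟩

theorem polyEquiv_aeval {R : Type*} [CommRing R] (n : ℕ) (f : R[X]) :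
    polyEquiv R n (aeval (MvPolynomial.X (0 : Fin (n + 1))) f) = MvPolynomial.C f := by
  rw [← AlgEquiv.coe_algHom, ← Polynomial.aeval_algHom_apply, AlgEquiv.coe_algHom]
  have : polyEquiv R n (MvPolynomial.X 0) = MvPolynomial.C (X : R[X]) := by
    simp [polyEquiv, MvPolynomial.optionEquivRight_X_none]
  rw [this]
  have h2 : aeval (MvPolynomial.C (X : R[X])) f =
      (Algebra.algHom R R[X] (MvPolynomial (Fin n) R[X])) (aeval X f) := by
    rw [← Polynomial.aeval_algHom_apply]; rfl
  rw [h2, aeval_X_left_apply]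
  rfl

theorem away_equiv {R : Type*} [CommRing R] (n : ℕ) (f : R[X]) :
    Nonempty (MvPolynomial (Fin n) (Localization.Away f) ≃+*
      Localization.Away (aeval (MvPolynomial.X (0 : Fin (n + 1))) f : MvPolynomial (Fin (n + 1)) R)) := by
  letI : Algebra (MvPolynomial (Fin n) R[X]) (MvPolynomial (Fin n) (Localization.Away f)) :=
    MvPolynomial.algebraMvPolynomial
  have h := MvPolynomial.isLocalization (σ := Fin n) (Submonoid.powers f) (Localization.Away f)
  have hm : (Submonoid.powers (aeval (MvPolynomial.X (0 : Fin (n + 1))) f)).map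
      (polyEquiv R n).toRingEquiv.toMonoidHom =
      (Submonoid.powers f).map (MvPolynomial.C : R[X] →+* MvPolynomial (Fin n) R[X]) := by
    rw [Submonoid.map_powers, Submonoid.map_powers]
    congr 1
    exact polyEquiv_aeval n f
  exact ⟨(IsLocalization.ringEquivOfRingEquiv
    (Localization.Away (aeval (MvPolynomial.X (0 : Fin (n + 1))) f : MvPolynomial (Fin (n + 1)) R))
    (MvPolynomial (Fin n) (Localization.Away f)) (polyEquiv R n).toRingEquiv hm).symm⟩

end S14
end PartF

/-- Let `R` be a valuation domain of finite Krull dimension `d`, let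
`f ∈ R[X]` be nonzero, and let `A = R[X, Y₁,…,Yₙ][f⁻¹]` be the localization of the
polynomial ring `R[X, Y₁,…,Yₙ]` away from `f`. Then every finitely generated stably free
`A`-module of rank `≥ d + 1` is free.  Here the polynomial ring in the variables
`X, Y₁, …, Yₙ` is realised as `MvPolynomial (Fin (n + 1)) R`, with `X` the variable of
index `0`. -/
theorem statement_14 (R : Type*) [CommRing R] [IsDomain R] [ValuationRing R]
    (d : ℕ) (hdim : ringKrullDim R = d)
    (n : ℕ) (f : Polynomial R) (hf : f ≠ 0)
    (P : Type*) [AddCommGroup P]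
    [Module (Localization.Away
      (Polynomial.aeval (MvPolynomial.X (0 : Fin (n + 1))) f : MvPolynomial (Fin (n + 1)) R)) P]
    [Module.Finite (Localization.Away
      (Polynomial.aeval (MvPolynomial.X (0 : Fin (n + 1))) f : MvPolynomial (Fin (n + 1)) R)) P]
    (r s : ℕ) (hr : d + 1 ≤ r)
    (hstab : Nonempty ((P × (Fin s → Localization.Away
        (Polynomial.aeval (MvPolynomial.X (0 : Fin (n + 1))) f : MvPolynomial (Fin (n + 1)) R)))
      ≃ₗ[Localization.Away
        (Polynomial.aeval (MvPolynomial.X (0 : Fin (n + 1))) f : MvPolynomial (Fin (n + 1)) R)]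
      (Fin (r + s) → Localization.Away
        (Polynomial.aeval (MvPolynomial.X (0 : Fin (n + 1))) f : MvPolynomial (Fin (n + 1)) R)))) :
    Nonempty (P ≃ₗ[Localization.Away
        (Polynomial.aeval (MvPolynomial.X (0 : Fin (n + 1))) f : MvPolynomial (Fin (n + 1)) R)]
      (Fin r → Localization.Away
        (Polynomial.aeval (MvPolynomial.X (0 : Fin (n + 1))) f : MvPolynomial (Fin (n + 1)) R))) := by
  obtain ⟨e⟩ := S14.away_equiv n f
  exact S14.cancel (d := d) (fun k hk => (S14.triv_main R d hdim.le k hk f hf n).equiv e) r hr s hstab
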